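/- Let B ⊆ ℝ be a countable set with 0 ∉ B. Then the set S := {(g, w) ∈ SL(2,ℝ) × ℝ² : (there exists ε > 0 with ‖b_t g m‖ ≥ ε for all t ∈ ℝ and all m ∈ ℤ² \ {0}) and closure{(gm+w)₁·(gm+w)₂ : m ∈ ℤ²} ∩ B = ∅} is thick; that is, for every open set U ⊆ M₂(ℝ) × ℝ² with U ∩ (SL(2,ℝ) × ℝ²) ≠ ∅, the Hausdorff dimension of S ∩ U equals 5. -/

import Mathlib

/-- The values of the form `Q₀(y) = y₁y₂` on the affine lattice `gℤ² + w`. -/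
def affValSet (g : Fin 2 → Fin 2 → ℝ) (w : Fin 2 → ℝ) : Set ℝ :=
  {v : ℝ | ∃ m₁ m₂ : ℤ,
    v = (g 0 0 * m₁ + g 0 1 * m₂ + w 0) * (g 1 0 * m₁ + g 1 1 * m₂ + w 1)}

/-- Membership of `g` (as a `2×2` array) in `SL(2,ℝ)`. -/
def isSL2 (g : Fin 2 → Fin 2 → ℝ) : Prop :=
  g 0 0 * g 1 1 - g 0 1 * g 1 0 = 1

/-- Matrix-vector multiplication for `2×2` arrays. -/
def matVec (g : Fin 2 → Fin 2 → ℝ) (y : Fin 2 → ℝ) : Fin 2 → ℝ :=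
  fun i => g i 0 * y 0 + g i 1 * y 1

/-- The product `b_t g` where `b_t = diag(e^t, e^{−t})`. -/
noncomputable def btMul (t : ℝ) (g : Fin 2 → Fin 2 → ℝ) : Fin 2 → Fin 2 → ℝ :=
  fun i j => (if i = 0 then Real.exp t else Real.exp (-t)) * g i j

/-- The Euclidean norm on `ℝ²`. -/
noncomputable def euclNorm2 (y : Fin 2 → ℝ) : ℝ :=
  Real.sqrt (y 0 ^ 2 + y 1 ^ 2)

open scoped ENNReal NNReal
open MeasureTheory

/-- The total weight of a set of words, a word of length `n` having weight `w ^ n`. -/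
noncomputable def wordWeight {D : Type*} (w : ℝ≥0∞) (A : Set (List D)) : ℝ≥0∞ :=
  ∑' u : A, w ^ (u : List D).length

theorem wordWeight_mono {D : Type*} (w : ℝ≥0∞) {A B : Set (List D)} (h : A ⊆ B) :
    wordWeight w A ≤ wordWeight w B :=
  ENNReal.tsum_mono_subtype (fun u : List D => w ^ u.length) h

theorem wordWeight_union_le {D : Type*} (w : ℝ≥0∞) (A B : Set (List D)) :
    wordWeight w (A ∪ B) ≤ wordWeight w A + wordWeight w B :=
  ENNReal.tsum_union_le (fun u : List D => w ^ u.length) A B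

theorem wordWeight_iUnion_le {D ι : Type*} (w : ℝ≥0∞) (A : ι → Set (List D)) :
    wordWeight w (⋃ i, A i) ≤ ∑' i, wordWeight w (A i) :=
  ENNReal.tsum_iUnion_le_tsum (fun u : List D => w ^ u.length) A

theorem wordWeight_eq_of_length {D : Type*} (w : ℝ≥0∞) (A : Set (List D)) (p : ℕ)
    (hA : ∀ u ∈ A, u.length = p) : wordWeight w A = A.encard * w ^ p := by
  unfold wordWeight
  rw [tsum_congr (fun u : A => by rw [hA u u.2]), ENNReal.tsum_const]
  rfl

theorem sum_wordWeight_le {D : Type*} [Fintype D] (w : ℝ≥0∞) (A : D → Set (List D))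
    (B : Set (List D)) (h : ∀ d, ∀ u ∈ A d, u ++ [d] ∈ B) :
    (∑ d, wordWeight w (A d)) * w ≤ wordWeight w B := by
  have hinj : Function.Injective
      (fun x : Σ d, A d => (⟨x.2.1 ++ [x.1], h x.1 x.2.1 x.2.2⟩ : B)) := by
    rintro ⟨d, u, hu⟩ ⟨d', u', hu'⟩ hx
    simp only [Subtype.mk.injEq] at hx
    obtain ⟨rfl, h2⟩ := List.append_inj' hx rfl
    simp only [List.cons.injEq, and_true] at h2
    subst h2
    rfl
  calc (∑ d, wordWeight w (A d)) * w
      = ∑' x : Σ d, A d, w ^ (x.2.1 ++ [x.1]).length := by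
        rw [ENNReal.tsum_sigma', tsum_fintype, Finset.sum_mul]
        refine Finset.sum_congr rfl fun d _ => ?_
        unfold wordWeight
        rw [← ENNReal.tsum_mul_right]
        simp [pow_succ]
    _ ≤ wordWeight w B :=
        ENNReal.tsum_comp_le_tsum_of_injective hinj (fun u : B => w ^ (u : List D).length)

/-- The words `u` extending `k` to an element of some `G k'`, with `k'` a suffix of `k`. -/
def forbiddenExt {D : Type*} (G : List D → Set (List D)) (k : List D) : Set (List D) :=
  {u | ∃ k', k' <:+ k ∧ u ++ k ∈ G k'}

theorem wordWeight_forbiddenExt_cons_le {D : Type*} (w : ℝ≥0∞) (G : List D → Set (List D))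
    (d : D) (k : List D) :
    wordWeight w (forbiddenExt G (d :: k)) ≤
      wordWeight w {u | ∃ k', k' <:+ k ∧ u ++ d :: k ∈ G k'} +
        wordWeight w {u | u ++ d :: k ∈ G (d :: k)} := by
  refine le_trans (wordWeight_mono w ?_) (wordWeight_union_le _ _ _)
  rintro u ⟨k', hk', hu⟩
  rcases List.suffix_cons_iff.1 hk' with rfl | h
  · exact Or.inr hu
  · exact Or.inl ⟨k', h, hu⟩

/-- If each node of a tree forbids only a small weight of its descendants, then there is a set of
nodes, none of them forbidden by an ancestor, in which every node has many children. -/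
theorem exists_subtree {D : Type*} [Fintype D] (w : ℝ≥0∞) (G : List D → Set (List D))
    (hG : ∀ k, wordWeight w {u | u ++ k ∈ G k} ≤ 1 / 4) (K : ℕ)
    (hK : ∀ c : ℕ, (c : ℝ≥0∞) * w ≤ 2 → K + c ≤ Fintype.card D) :
    ∃ S : Set (List D), [] ∈ S ∧ (∀ k ∈ S, K ≤ {d | d :: k ∈ S}.ncard) ∧
      ∀ k ∈ S, ∀ k', k' <:+ k → k ∉ G k' := by
  classical
  have h44 : (1 / 4 : ℝ≥0∞) + 1 / 4 = 1 / 2 := by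
    rw [← ENNReal.toReal_eq_toReal_iff' (by finiteness) (by finiteness),
      ENNReal.toReal_add (by finiteness) (by finiteness)]
    norm_num
  refine ⟨{k | wordWeight w (forbiddenExt G k) ≤ 1 / 2}, ?_, ?_, ?_⟩
  · have h : forbiddenExt G [] = {u | u ++ [] ∈ G []} := by
      ext u
      simp [forbiddenExt]
    simp only [Set.mem_ofPred_eq, h]
    exact (hG []).trans (by rw [← h44]; exact le_self_add)
  · intro k hk
    set old : D → Set (List D) := fun d => {u | ∃ k', k' <:+ k ∧ u ++ d :: k ∈ G k'} with hold
    set X : Finset D := {d | 1 / 4 < wordWeight w (old d)} with hX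
    have hsum : (∑ d, wordWeight w (old d)) * w ≤ 1 / 2 := by
      refine le_trans (sum_wordWeight_le w old (forbiddenExt G k) ?_) hk
      rintro d u ⟨k', hk', hu⟩
      exact ⟨k', hk', by simpa using hu⟩
    have hcard : (X.card : ℝ≥0∞) * w ≤ 2 := by
      have h1 : (X.card : ℝ≥0∞) * (1 / 4) ≤ ∑ d, wordWeight w (old d) := by
        calc (X.card : ℝ≥0∞) * (1 / 4) = ∑ d ∈ X, (1 / 4 : ℝ≥0∞) := by simp
          _ ≤ ∑ d ∈ X, wordWeight w (old d) :=
            Finset.sum_le_sum fun d hd => (Finset.mem_filter.1 hd).2.le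
          _ ≤ _ := Finset.sum_le_sum_of_subset (Finset.subset_univ _)
      calc (X.card : ℝ≥0∞) * w = 4 * ((X.card : ℝ≥0∞) * (1 / 4) * w) := by
            have : (4 : ℝ≥0∞) * (1 / 4) = 1 := by
              rw [one_div]
              exact ENNReal.mul_inv_cancel (by norm_num) (by norm_num)
            calc (X.card : ℝ≥0∞) * w = (4 * (1 / 4)) * ((X.card : ℝ≥0∞) * w) := by
                  rw [this, one_mul]
              _ = _ := by ring
        _ ≤ 4 * (1 / 2) := by gcongr; exact le_trans (by gcongr) hsum
        _ = 2 := by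
          rw [← ENNReal.toReal_eq_toReal_iff' (by finiteness) (by finiteness)]
          norm_num
    have hK' := hK _ hcard
    have hsub : ((Xᶜ : Finset D) : Set D) ⊆
        {d | d :: k ∈ {k | wordWeight w (forbiddenExt G k) ≤ 1 / 2}} := by
      intro d hd
      have hd' : wordWeight w (old d) ≤ 1 / 4 := by
        simpa [hX] using hd
      calc wordWeight w (forbiddenExt G (d :: k)) ≤ _ := wordWeight_forbiddenExt_cons_le w G d k
        _ ≤ 1 / 4 + 1 / 4 := add_le_add hd' (hG _)
        _ = 1 / 2 := h44
    have h2 := Set.ncard_le_ncard hsub (Set.toFinite _)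
    rw [Set.ncard_coe_finset] at h2
    have h3 := Finset.card_add_card_compl X
    omega
  · intro k hk k' hk' hmem
    have h1 : ([] : List D) ∈ forbiddenExt G k := ⟨k', hk', by simpa using hmem⟩
    have h2 : (1 : ℝ≥0∞) ≤ wordWeight w (forbiddenExt G k) := by
      simpa [wordWeight] using
        ENNReal.le_tsum (f := fun u : forbiddenExt G k => w ^ (u : List D).length)
        ⟨[], h1⟩
    have h3 : (1 : ℝ≥0∞) ≤ 1 / 2 := h2.trans hk
    have := ENNReal.toReal_mono (by finiteness) h3
    norm_num at this

theorem exists_branch_measure {D : Type*} [Countable D] (S : Set (List D)) (h0 : [] ∈ S)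
    (K : ℕ) (hK : 0 < K) (hS : ∀ k ∈ S, K ≤ {d | d :: k ∈ S}.ncard) :
    ∃ (ν : ℕ → (ℕ → Fin K) → List D) (μ : Measure (ℕ → Fin K)), IsProbabilityMeasure μ ∧
      (∀ n δ, (ν n δ).length = n ∧ ν n δ ∈ S ∧ ∃ d, ν (n + 1) δ = d :: ν n δ) ∧
      (∀ n k, MeasurableSet {δ | ν n δ = k}) ∧
      ∀ n k, μ {δ | ν n δ = k} ≤ ((K : ℝ≥0∞)⁻¹) ^ n := by
  classical
  have : NeZero K := ⟨hK.ne'⟩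
  have he : ∀ k : List D, ∃ e : Fin K → D, k ∈ S →
      Function.Injective e ∧ ∀ i, e i :: k ∈ S := by
    intro k
    by_cases hk : k ∈ S
    · have h1 := hS k hk
      have hfin : {d | d :: k ∈ S}.Finite := Set.finite_of_ncard_pos (hK.trans_le h1)
      rw [Set.ncard_eq_toFinset_card _ hfin] at h1
      obtain ⟨T, hT, hTc⟩ := Finset.exists_subset_card_eq h1
      refine ⟨fun i => (T.equivFinOfCardEq hTc).symm i, fun _ => ⟨?_, fun i => ?_⟩⟩
      · exact Subtype.val_injective.comp (Equiv.injective _)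
      · have := hT ((T.equivFinOfCardEq hTc).symm i).2
        simpa using this
    · have h1 := hS [] h0
      have hne : {d | d :: [] ∈ S}.Nonempty := by
        rw [Set.nonempty_iff_ne_empty]
        intro h
        rw [h, Set.ncard_empty] at h1
        omega
      exact ⟨fun _ => hne.some, fun h => absurd h hk⟩
  choose e he using he
  let ν : ℕ → (ℕ → Fin K) → List D := fun n δ =>
    Nat.rec [] (fun i k => e k (δ i) :: k) n
  have hν : ∀ n δ, ν (n + 1) δ = e (ν n δ) (δ n) :: ν n δ := fun n δ => rfl
  have hνS : ∀ n δ, (ν n δ).length = n ∧ ν n δ ∈ S := by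
    intro n δ
    induction n with
    | zero => exact ⟨rfl, h0⟩
    | succ n ih =>
      rw [hν]
      exact ⟨by simp [ih.1], (he _ ih.2).2 _⟩
  have hinj : ∀ n δ δ', ν n δ = ν n δ' → ∀ i < n, δ i = δ' i := by
    intro n δ δ'
    induction n with
    | zero => intro _ i hi; omega
    | succ n ih =>
      intro h i hi
      rw [hν, hν] at h
      obtain ⟨h1, h2⟩ := List.cons.inj h
      rcases Nat.lt_succ_iff_lt_or_eq.1 hi with hi | rfl
      · exact ih h2 i hi
      · rw [h2] at h1
        exact (he _ (hνS _ _).2).1 h1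
  let P : Measure (Fin K) := ProbabilityTheory.uniformOn Set.univ
  have : IsProbabilityMeasure P :=
    ProbabilityTheory.isProbabilityMeasure_uniformOn Set.finite_univ Set.univ_nonempty
  have hP : ∀ i, P {i} = (K : ℝ≥0∞)⁻¹ := by
    intro i
    simp [P, ProbabilityTheory.uniformOn_univ]
  refine ⟨ν, Measure.infinitePi (fun _ => P), inferInstance,
    fun n δ => ⟨(hνS n δ).1, (hνS n δ).2, _, hν n δ⟩, ?_, ?_⟩
  · intro n
    let : MeasurableSpace (List D) := ⊤
    have hm : Measurable (ν n) := by
      induction n with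
      | zero => exact measurable_const
      | succ n ih =>
        have : ν (n + 1) = (fun x : List D × Fin K => e x.1 x.2 :: x.1) ∘
            fun δ => (ν n δ, δ n) := rfl
        rw [this]
        exact Measurable.comp (measurable_from_prod_countable_right fun _ => measurable_from_top)
          (ih.prodMk (measurable_pi_apply n))
    intro k
    exact hm (MeasurableSpace.measurableSet_top : MeasurableSet {k})
  · intro n k
    rcases Set.eq_empty_or_nonempty {δ | ν n δ = k} with h | ⟨δ₀, h⟩
    · rw [h]; simp
    · have hsub : {δ | ν n δ = k} ⊆
          Set.pi (Finset.range n : Set ℕ) (fun i => ({δ₀ i} : Set (Fin K))) := by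
        intro δ hδ i hi
        exact hinj n δ δ₀ (hδ.trans h.symm) i (by simpa using hi)
      refine (measure_mono hsub).trans ?_
      rw [Measure.infinitePi_pi _ (fun _ _ => MeasurableSet.singleton _)]
      simp [hP]

/-- The index vector of the word `k` of digits: `wordIdx k j` is the integer whose base `M j`
expansion is given by the `j`-th components of the letters of `k`, last digit first. -/
def wordIdx {J : Type*} {M : J → ℕ} : List (∀ j, Fin (M j)) → J → ℕ
  | [], _ => 0
  | d :: k, j => M j * wordIdx k j + d j

theorem wordIdx_append {J : Type*} {M : J → ℕ} (u k : List (∀ j, Fin (M j))) (j : J) :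
    wordIdx (u ++ k) j = M j ^ u.length * wordIdx k j + wordIdx u j := by
  induction u with
  | nil => simp [wordIdx]
  | cons d u ih =>
    simp only [List.cons_append, wordIdx, ih, List.length_cons]
    ring

theorem wordIdx_lt {J : Type*} {M : J → ℕ} (u : List (∀ j, Fin (M j))) (j : J) :
    wordIdx u j < M j ^ u.length := by
  induction u with
  | nil => simp [wordIdx]
  | cons d u ih =>
    simp only [wordIdx, List.length_cons, pow_succ']
    have h2 := Nat.mul_le_mul_left (M j) (Nat.succ_le_of_lt ih)
    rw [Nat.mul_succ] at h2
    omega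

theorem wordIdx_injective {J : Type*} {M : J → ℕ} {u v : List (∀ j, Fin (M j))}
    (hl : u.length = v.length) (h : wordIdx u = wordIdx v) : u = v := by
  induction u generalizing v with
  | nil => exact (List.eq_nil_of_length_eq_zero hl.symm).symm
  | cons d u ih =>
    rcases v with _ | ⟨e, v⟩
    · simp at hl
    · have h1 : ∀ j, (d j : ℕ) = e j ∧ wordIdx u j = wordIdx v j := by
        intro j
        have h2 : M j * wordIdx u j + d j = M j * wordIdx v j + e j := congrFun h j
        have hd := (d j).2
        have he := (e j).2
        have h3 : (d j : ℕ) = e j := by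
          have := congrArg (· % M j) h2
          simpa [Nat.mul_add_mod, Nat.mod_eq_of_lt hd, Nat.mod_eq_of_lt he] using this
        refine ⟨h3, ?_⟩
        rw [h3] at h2
        exact Nat.eq_of_mul_eq_mul_left (by omega) (Nat.add_right_cancel h2)
      rw [ih (by simpa using hl) (funext fun j => (h1 j).2),
        funext fun j => Fin.ext (h1 j).1]

/-- The closed box of the unit cube consisting of the points whose expansions begin with the
digits of `k`. -/
def wordBox {J : Type*} {M : J → ℕ} (k : List (∀ j, Fin (M j))) : Set (J → ℝ) :=
  {t | ∀ j, (wordIdx k j : ℝ) ≤ t j * M j ^ k.length ∧ t j * M j ^ k.length ≤ wordIdx k j + 1}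

theorem wordBox_nonempty_corner {J : Type*} {M : J → ℕ} (hM : ∀ j, 0 < M j)
    (k : List (∀ j, Fin (M j))) :
    (fun j => (wordIdx k j : ℝ) / (M j : ℝ) ^ k.length) ∈ wordBox k := by
  intro j
  have : (0 : ℝ) < M j := by exact_mod_cast hM j
  rw [div_mul_cancel₀ _ (by positivity)]
  exact ⟨le_rfl, by linarith⟩

theorem wordBox_cons_subset {J : Type*} {M : J → ℕ} (d : ∀ j, Fin (M j))
    (k : List (∀ j, Fin (M j))) : wordBox (d :: k) ⊆ wordBox k := by
  intro t ht j
  obtain ⟨h1, h2⟩ := ht j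
  have hd : (d j : ℕ) + 1 ≤ M j := (d j).2
  have hd' : ((d j : ℕ) : ℝ) + 1 ≤ M j := by exact_mod_cast hd
  have hM : (0 : ℝ) < M j := by linarith
  simp only [wordIdx, List.length_cons, pow_succ] at h1 h2
  push_cast at h1 h2
  constructor
  · refine le_of_mul_le_mul_left ?_ hM
    nlinarith
  · refine le_of_mul_le_mul_left ?_ hM
    nlinarith

theorem wordBox_antitone {J : Type*} {M : J → ℕ} {k l : List (∀ j, Fin (M j))}
    (h : k <:+ l) : wordBox l ⊆ wordBox k := by
  obtain ⟨u, rfl⟩ := h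
  induction u with
  | nil => exact subset_rfl
  | cons d u ih => exact (wordBox_cons_subset d _).trans ih

/-- The words of length `n` whose boxes meet a small set are few. -/
theorem ncard_wordBox_inter_le {J : Type*} [Fintype J] {M : J → ℕ} (U : Set (J → ℝ)) (r : ℝ)
    (hU : ∀ x ∈ U, ∀ y ∈ U, ∀ j, |x j - y j| ≤ r) (n : ℕ) (hr : ∀ j, 1 ≤ r * M j ^ n) :
    {k : List (∀ j, Fin (M j)) | k.length = n ∧ (wordBox k ∩ U).Nonempty}.Finite ∧
    ({k : List (∀ j, Fin (M j)) | k.length = n ∧ (wordBox k ∩ U).Nonempty}.ncard : ℝ) ≤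
      (4 * r) ^ Fintype.card J * (∏ j, (M j : ℝ)) ^ n := by
  classical
  set A := {k : List (∀ j, Fin (M j)) | k.length = n ∧ (wordBox k ∩ U).Nonempty} with hA
  rcases U.eq_empty_or_nonempty with rfl | ⟨x, hx⟩
  · have : A = ∅ := by simp [hA]
    rw [this]
    refine ⟨Set.finite_empty, ?_⟩
    simp only [Set.ncard_empty, Nat.cast_zero]
    rcases isEmpty_or_nonempty J with hJ | ⟨⟨j⟩⟩
    · simp
    · have h1 := hr j
      have h2 : (0 : ℝ) ≤ (M j : ℝ) ^ n := by positivity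
      have : 0 ≤ r := by
        by_contra h
        nlinarith
      positivity
  set T : Finset (J → ℤ) := Fintype.piFinset fun j =>
    Finset.Icc ⌈(x j - r) * M j ^ n - 1⌉ ⌊(x j + r) * (M j : ℝ) ^ n⌋ with hT
  have hmaps : ∀ k ∈ A, (fun j => (wordIdx k j : ℤ)) ∈ T := by
    rintro k ⟨hk, y, hyk, hyU⟩
    rw [hT, Fintype.mem_piFinset]
    intro j
    obtain ⟨h1, h2⟩ := hyk j
    rw [hk] at h1 h2
    have h3 := abs_le.1 (hU x hx y hyU j)
    have hp : (0 : ℝ) ≤ (M j : ℝ) ^ n := by positivity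
    rw [Finset.mem_Icc, Int.ceil_le, Int.le_floor]
    push_cast
    constructor <;> nlinarith
  have hinj : Set.InjOn (fun (k : List (∀ j, Fin (M j))) (j : J) => (wordIdx k j : ℤ)) A := by
    intro k hk l hl h
    refine wordIdx_injective (hk.1.trans hl.1.symm) (funext fun j => ?_)
    have h1 : (wordIdx k j : ℤ) = wordIdx l j := congrFun h j
    exact_mod_cast h1
  have hfin : A.Finite := Set.Finite.of_injOn hmaps hinj T.finite_toSet
  refine ⟨hfin, ?_⟩
  have hcard : A.ncard ≤ T.card := by
    rw [← Set.ncard_coe_finset]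
    exact Set.ncard_le_ncard_of_injOn _ hmaps hinj T.finite_toSet
  calc (A.ncard : ℝ) ≤ T.card := by exact_mod_cast hcard
    _ = ∏ j, ((Finset.Icc ⌈(x j - r) * M j ^ n - 1⌉ ⌊(x j + r) * (M j : ℝ) ^ n⌋).card : ℝ) := by
      rw [hT, Fintype.card_piFinset]
      push_cast
      rfl
    _ ≤ ∏ j, (4 * r * (M j : ℝ) ^ n) := by
      refine Finset.prod_le_prod (fun _ _ => Nat.cast_nonneg _) fun j _ => ?_
      have h1 := hr j
      rw [Int.card_Icc]
      have h2 : (((⌊(x j + r) * (M j : ℝ) ^ n⌋ + 1 - ⌈(x j - r) * M j ^ n - 1⌉).toNat : ℤ) : ℝ)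
          ≤ 4 * r * (M j : ℝ) ^ n := by
        rw [Int.toNat_eq_max]
        push_cast
        refine max_le ?_ (by nlinarith)
        have := Int.floor_le ((x j + r) * (M j : ℝ) ^ n)
        have := Int.le_ceil ((x j - r) * (M j : ℝ) ^ n - 1)
        nlinarith
      exact_mod_cast h2
    _ = _ := by
      rw [Finset.prod_mul_distrib, Finset.prod_const, Finset.card_univ, Finset.prod_pow]

/-- The limit set of a tree of boxes. -/
def treeLimit {J : Type*} {M : J → ℕ} (S : Set (List (∀ j, Fin (M j)))) : Set (J → ℝ) :=
  {t | ∃ ν : ℕ → List (∀ j, Fin (M j)), ∀ n, (ν n).length = n ∧ ν n ∈ S ∧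
    (∃ d, ν (n + 1) = d :: ν n) ∧ t ∈ wordBox (ν n)}

theorem exists_limit_map {J : Type*} [Finite J] {M : J → ℕ} (hM : ∀ j, 0 < M j)
    (S : Set (List (∀ j, Fin (M j)))) (h0 : [] ∈ S) (K : ℕ) (hK : 0 < K)
    (hS : ∀ k ∈ S, K ≤ {d | d :: k ∈ S}.ncard) :
    ∃ (μ : Measure (ℕ → Fin K)) (ν : ℕ → (ℕ → Fin K) → List (∀ j, Fin (M j)))
      (L : (ℕ → Fin K) → J → ℝ), IsProbabilityMeasure μ ∧ Measurable L ∧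
      (∀ δ, L δ ∈ treeLimit S) ∧ (∀ n δ, (ν n δ).length = n ∧ L δ ∈ wordBox (ν n δ)) ∧
      ∀ n k, μ {δ | ν n δ = k} ≤ ((K : ℝ≥0∞)⁻¹) ^ n := by
  obtain ⟨ν, μ, hμ, hν, hmeas, hμν⟩ := exists_branch_measure S h0 K hK hS
  have hM' : ∀ j, (0 : ℝ) < M j := fun j => by exact_mod_cast hM j
  have hIcc : ∀ δ j, Antitone fun n => Set.Icc
      ((wordIdx (ν n δ) j : ℝ) / (M j : ℝ) ^ n) (((wordIdx (ν n δ) j : ℝ) + 1) / (M j : ℝ) ^ n) := by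
    intro δ j
    refine antitone_nat_of_succ_le fun n => ?_
    obtain ⟨d, hd⟩ := (hν n δ).2.2
    have hd1 : ((d j : ℕ) : ℝ) + 1 ≤ M j := by exact_mod_cast (d j).2
    have hMj := hM' j
    refine Set.Icc_subset_Icc ?_ ?_
    · rw [hd, div_le_div_iff₀ (by positivity) (by positivity), wordIdx, pow_succ]
      push_cast
      have : (0 : ℝ) ≤ (d j : ℕ) * (M j : ℝ) ^ n := by positivity
      nlinarith
    · rw [hd, div_le_div_iff₀ (by positivity) (by positivity), wordIdx, pow_succ]
      push_cast
      have : (((d j : ℕ) : ℝ) + 1) * (M j : ℝ) ^ n ≤ M j * (M j : ℝ) ^ n := by gcongr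
      nlinarith
  let L : (ℕ → Fin K) → J → ℝ := fun δ j => ⨆ n, (wordIdx (ν n δ) j : ℝ) / (M j : ℝ) ^ n
  have hL : ∀ n δ, L δ ∈ wordBox (ν n δ) := by
    intro n δ j
    have h1 := ciSup_mem_iInter_Icc_of_antitone_Icc (hIcc δ j) fun n => by
      have := hM' j
      gcongr
      linarith
    have h2 := Set.mem_iInter.1 h1 n
    have := hM' j
    rw [(hν n δ).1]
    exact ⟨(div_le_iff₀ (by positivity)).1 h2.1, (le_div_iff₀ (by positivity)).1 h2.2⟩
  refine ⟨μ, ν, L, hμ, ?_, fun δ => ⟨fun n => ν n δ, fun n => ⟨(hν n δ).1, (hν n δ).2.1,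
    (hν n δ).2.2, hL n δ⟩⟩, fun n δ => ⟨(hν n δ).1, hL n δ⟩, hμν⟩
  refine measurable_pi_lambda _ fun j => Measurable.iSup fun n => ?_
  let : MeasurableSpace (List (∀ j, Fin (M j))) := ⊤
  have h1 : Measurable (ν n) := measurable_to_countable' fun k => hmeas n k
  exact (measurable_from_top (f := fun k : List (∀ j, Fin (M j)) =>
    (wordIdx k j : ℝ) / (M j : ℝ) ^ n)).comp h1

theorem le_dimH_treeLimit {J : Type*} [Fintype J] {N : ℕ} (hN : 2 ≤ N) {M : J → ℕ}
    (hM : ∀ j, N ≤ M j) (S : Set (List (∀ j, Fin (M j)))) (h0 : [] ∈ S) (K : ℕ) (hK : 0 < K)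
    (hS : ∀ k ∈ S, K ≤ {d | d :: k ∈ S}.ncard) (s : ℝ≥0) (hs0 : 0 < s) (hs : s ≤ Fintype.card J)
    (hKs : ∏ j, (M j : ℝ) ≤ K * (N : ℝ) ^ ((Fintype.card J : ℝ) - s)) :
    (s : ℝ≥0∞) ≤ dimH (treeLimit S) := by
  obtain ⟨μ, ν, L, hμ, hLm, hLE, hLν, hμν⟩ :=
    exists_limit_map (fun j => by have := hM j; omega) S h0 K hK hS
  set c := Fintype.card J with hc
  set C : ℝ := 4 ^ c * (N : ℝ) ^ ((c : ℝ) - s) with hC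
  have hN' : (2 : ℝ) ≤ N := by exact_mod_cast hN
  have hN0 : (0 : ℝ) < N := by linarith
  have hC0 : 0 < C := by positivity
  have hK' : (0 : ℝ) < K := by exact_mod_cast hK
  have key : ∀ (U : Set (J → ℝ)) (r : ℝ), 0 < r → r ≤ 1 →
      (∀ x ∈ U, ∀ y ∈ U, ∀ j, |x j - y j| ≤ r) → μ (L ⁻¹' U) ≤ ENNReal.ofReal (C * r ^ (s : ℝ)) := by
    intro U r hr0 hr1 hU
    obtain ⟨n, hn1, hn2⟩ := exists_nat_pow_near_of_lt_one hr0 hr1 (y := (N : ℝ)⁻¹)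
      (by positivity) (inv_lt_one_of_one_lt₀ (by linarith))
    have hNn : (N : ℝ) ^ (n + 1) ≤ N / r := by
      rw [inv_pow] at hn2
      rw [le_div_iff₀ hr0, pow_succ]
      have : r * (N : ℝ) ^ n ≤ 1 := by
        calc r * (N : ℝ) ^ n ≤ ((N : ℝ) ^ n)⁻¹ * (N : ℝ) ^ n := by gcongr
          _ = 1 := inv_mul_cancel₀ (by positivity)
      nlinarith
    have hrM : ∀ j, 1 ≤ r * (M j : ℝ) ^ (n + 1) := by
      intro j
      rw [inv_pow] at hn1
      have hNM : (N : ℝ) ≤ M j := by exact_mod_cast hM j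
      calc (1 : ℝ) = ((N : ℝ) ^ (n + 1))⁻¹ * (N : ℝ) ^ (n + 1) :=
            (inv_mul_cancel₀ (by positivity)).symm
        _ ≤ r * (M j : ℝ) ^ (n + 1) := by gcongr
    obtain ⟨hfin, hcard⟩ := ncard_wordBox_inter_le (M := M) U r hU (n + 1) hrM
    set A := {k : List (∀ j, Fin (M j)) | k.length = n + 1 ∧ (wordBox k ∩ U).Nonempty} with hA
    have hsub : L ⁻¹' U ⊆ ⋃ k ∈ hfin.toFinset, {δ | ν (n + 1) δ = k} := by
      intro δ hδ
      simp only [Set.mem_iUnion]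
      exact ⟨ν (n + 1) δ, hfin.mem_toFinset.2
        ⟨(hLν _ _).1, L δ, (hLν _ _).2, hδ⟩, rfl⟩
    have h1 : μ (L ⁻¹' U) ≤ (A.ncard : ℝ≥0∞) * ((K : ℝ≥0∞)⁻¹) ^ (n + 1) := by
      calc μ (L ⁻¹' U) ≤ ∑ k ∈ hfin.toFinset, μ {δ | ν (n + 1) δ = k} :=
            (measure_mono hsub).trans (measure_biUnion_finset_le _ _)
        _ ≤ ∑ k ∈ hfin.toFinset, ((K : ℝ≥0∞)⁻¹) ^ (n + 1) :=
            Finset.sum_le_sum fun k _ => hμν _ _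
        _ = _ := by rw [Finset.sum_const, nsmul_eq_mul, Set.ncard_eq_toFinset_card _ hfin]
    have h2 : (A.ncard : ℝ) * ((K : ℝ)⁻¹) ^ (n + 1) ≤ C * r ^ (s : ℝ) := by
      have hsc : 0 ≤ (c : ℝ) - s := by
        have : (s : ℝ) ≤ c := by exact_mod_cast hs
        linarith
      calc (A.ncard : ℝ) * ((K : ℝ)⁻¹) ^ (n + 1)
          ≤ ((4 * r) ^ c * (∏ j, (M j : ℝ)) ^ (n + 1)) * ((K : ℝ)⁻¹) ^ (n + 1) := by gcongr
        _ ≤ ((4 * r) ^ c * (K * (N : ℝ) ^ ((c : ℝ) - s)) ^ (n + 1)) * ((K : ℝ)⁻¹) ^ (n + 1) := by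
            gcongr
        _ = (4 * r) ^ c * ((N : ℝ) ^ (n + 1)) ^ ((c : ℝ) - s) := by
            rw [mul_pow (K : ℝ), ← Real.rpow_natCast, ← Real.rpow_natCast (_ ^ _),
              ← Real.rpow_mul hN0.le, ← Real.rpow_natCast (N : ℝ), ← Real.rpow_mul hN0.le,
              mul_comm ((c : ℝ) - s), inv_pow, Real.rpow_natCast (4 * r)]
            field_simp
        _ ≤ (4 * r) ^ c * (N / r) ^ ((c : ℝ) - s) := by gcongr
        _ = C * r ^ (s : ℝ) := by
            rw [Real.div_rpow hN0.le hr0.le, Real.rpow_sub hr0, Real.rpow_natCast, hC, mul_pow]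
            have : r ^ (s : ℝ) ≠ 0 := by positivity
            field_simp
    refine h1.trans ?_
    rw [← ENNReal.ofReal_natCast K, ← ENNReal.ofReal_inv_of_pos hK',
      ← ENNReal.ofReal_pow (by positivity), ← ENNReal.ofReal_natCast A.ncard,
      ← ENNReal.ofReal_mul (by positivity)]
    exact ENNReal.ofReal_le_ofReal h2
  have hdiam : ∀ U : Set (J → ℝ), Metric.ediam U ≤ 1 →
      μ.map L U ≤ ENNReal.ofReal C * Metric.ediam U ^ (s : ℝ) := by
    intro U hU
    have hsmall : ∀ r : ℝ, 0 < r → r ≤ 1 → Metric.ediam U ≤ ENNReal.ofReal r →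
        μ.map L U ≤ ENNReal.ofReal (C * r ^ (s : ℝ)) := by
      intro r hr0 hr1 hr
      calc μ.map L U ≤ μ.map L (closure U) := measure_mono subset_closure
        _ = μ (L ⁻¹' closure U) := Measure.map_apply hLm isClosed_closure.measurableSet
        _ ≤ _ := by
          refine key _ r hr0 hr1 fun x hx y hy j => ?_
          have h1 : edist x y ≤ ENNReal.ofReal r :=
            (Metric.edist_le_ediam_of_mem hx hy).trans (by rwa [Metric.ediam_closure])
          rw [edist_dist, ENNReal.ofReal_le_ofReal_iff hr0.le] at h1
          rw [← Real.dist_eq]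
          exact (dist_le_pi_dist x y j).trans h1
    have hfin : Metric.ediam U ≠ ∞ := ne_top_of_le_ne_top ENNReal.one_ne_top hU
    set r := (Metric.ediam U).toReal with hr
    have hrU : Metric.ediam U = ENNReal.ofReal r := (ENNReal.ofReal_toReal hfin).symm
    have hr1 : r ≤ 1 := by simpa using ENNReal.toReal_mono ENNReal.one_ne_top hU
    rcases (ENNReal.toReal_nonneg : 0 ≤ r).eq_or_lt with h | h
    · have h2 : μ.map L U ≤ 0 := by
        have hlim : Filter.Tendsto (fun r : ℝ => ENNReal.ofReal (C * r ^ (s : ℝ)))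
            (nhdsWithin 0 (Set.Ioi 0)) (nhds 0) := by
          have h3 : Continuous fun r : ℝ => ENNReal.ofReal (C * r ^ (s : ℝ)) :=
            ENNReal.continuous_ofReal.comp
              (continuous_const.mul (Real.continuous_rpow_const (NNReal.coe_nonneg s)))
          have h4 := h3.tendsto 0
          rw [Real.zero_rpow (by exact_mod_cast hs0.ne'), mul_zero, ENNReal.ofReal_zero] at h4
          exact h4.mono_left nhdsWithin_le_nhds
        refine ge_of_tendsto hlim ?_
        filter_upwards [Ioc_mem_nhdsGT (zero_lt_one (α := ℝ))] with x hx
        exact hsmall x hx.1 hx.2 (by rw [hrU, hr, ← h]; simp)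
      exact h2.trans zero_le
    · rw [hrU, ENNReal.ofReal_rpow_of_pos h, ← ENNReal.ofReal_mul hC0.le]
      exact hsmall r h hr1 hrU.le
  have hle : (ENNReal.ofReal C)⁻¹ • μ.map L ≤ Measure.hausdorffMeasure (s : ℝ) := by
    refine Measure.le_hausdorffMeasure _ _ 1 one_pos fun U hU => ?_
    rw [Measure.smul_apply, smul_eq_mul]
    calc (ENNReal.ofReal C)⁻¹ * μ.map L U
        ≤ (ENNReal.ofReal C)⁻¹ * (ENNReal.ofReal C * Metric.ediam U ^ (s : ℝ)) := by
          gcongr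
          exact hdiam U hU
      _ = Metric.ediam U ^ (s : ℝ) := by
          rw [← mul_assoc, ENNReal.inv_mul_cancel (by simpa using hC0) ENNReal.ofReal_ne_top,
            one_mul]
  refine le_dimH_of_hausdorffMeasure_ne_zero (ne_of_gt ?_)
  refine lt_of_lt_of_le ?_ (hle (treeLimit S))
  rw [Measure.smul_apply, smul_eq_mul]
  refine ENNReal.mul_pos (by simp) (ne_of_gt ?_)
  calc (0 : ℝ≥0∞) < 1 := one_pos
    _ = μ (L ⁻¹' treeLimit S) := by
      rw [Set.eq_univ_of_forall (s := L ⁻¹' treeLimit S) hLE, measure_univ]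
    _ ≤ μ.map L (treeLimit S) := Measure.le_map_apply hLm.aemeasurable _

/-- Few words of length `p` belong to a set that is thin in one direction. -/
theorem encard_mul_le_of_thin {J : Type*} [Fintype J] {M : J → ℕ} (j₀ : J) (W p : ℕ)
    (A : Set (List (∀ j, Fin (M j)))) (hlen : ∀ u ∈ A, u.length = p)
    (hthin : ∀ u ∈ A, ∀ v ∈ A, (∀ j, j ≠ j₀ → wordIdx u j = wordIdx v j) →
      wordIdx u j₀ ≤ wordIdx v j₀ + W) :
    A.encard * (M j₀ ^ p : ℕ) ≤ ((W + 1) * (∏ j, M j) ^ p : ℕ) := by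
  classical
  have hinj : Set.InjOn wordIdx A := fun u hu v hv h =>
    wordIdx_injective ((hlen u hu).trans (hlen v hv).symm) h
  have hfin : A.Finite := by
    refine Set.Finite.of_injOn (f := wordIdx)
      (t := (Fintype.piFinset fun j => Finset.range (M j ^ p) : Finset (J → ℕ))) ?_ hinj
      (Finset.finite_toSet _)
    intro u hu
    simp only [Finset.mem_coe, Fintype.mem_piFinset, Finset.mem_range]
    intro j
    rw [← hlen u hu]
    exact wordIdx_lt u j
  let f : List (∀ j, Fin (M j)) → J → ℕ := fun u => Function.update (wordIdx u) j₀ 0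
  let T : Finset (J → ℕ) :=
    Fintype.piFinset (Function.update (fun j => Finset.range (M j ^ p)) j₀ {0})
  have hcard : hfin.toFinset.card ≤ (W + 1) * T.card := by
    refine Finset.card_le_mul_card_image_of_maps_to (f := f) (t := T) ?_ _ ?_
    · intro u hu
      rw [Fintype.mem_piFinset]
      intro j
      by_cases hj : j = j₀
      · subst hj; simp [f]
      · simp only [f, Function.update_of_ne hj, Finset.mem_range]
        rw [← hlen u (hfin.mem_toFinset.1 hu)]
        exact wordIdx_lt u j
    · intro y _
      set X := hfin.toFinset.filter (fun u => f u = y) with hX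
      rcases X.eq_empty_or_nonempty with h | h
      · simp [h]
      · obtain ⟨v, hv, hmin⟩ := X.exists_min_image (fun u => wordIdx u j₀) h
        have hXA : ∀ u ∈ X, u ∈ A ∧ f u = y := fun u hu => by
          simpa [hX] using hu
        have hoff : ∀ u ∈ X, ∀ v ∈ X, ∀ j, j ≠ j₀ → wordIdx u j = wordIdx v j := by
          intro u hu v hv j hj
          have := congrFun ((hXA u hu).2.trans (hXA v hv).2.symm) j
          simpa [f, Function.update_of_ne hj] using this
        have h1 : X.card ≤ (Finset.Icc (wordIdx v j₀) (wordIdx v j₀ + W)).card := by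
          refine Finset.card_le_card_of_injOn (fun u => wordIdx u j₀) ?_ ?_
          · intro u hu
            rw [Finset.mem_coe, Finset.mem_Icc]
            exact ⟨hmin u hu, hthin u (hXA u hu).1 v (hXA v hv).1 (hoff u hu v hv)⟩
          · intro u hu u' hu' h
            refine hinj (hXA u hu).1 (hXA u' hu').1 (funext fun j => ?_)
            by_cases hj : j = j₀
            · subst hj; exact h
            · exact hoff u hu u' hu' j hj
        rw [Nat.card_Icc] at h1
        omega
  have hT : T.card * M j₀ ^ p = (∏ j, M j) ^ p := by
    rw [Fintype.card_piFinset, ← Finset.mul_prod_erase _ _ (Finset.mem_univ j₀),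
      ← Finset.mul_prod_erase _ _ (Finset.mem_univ j₀), mul_pow, ← Finset.prod_pow]
    simp only [Function.update_self, Finset.card_singleton, one_mul]
    rw [mul_comm]
    congr 1
    refine Finset.prod_congr rfl fun j hj => ?_
    rw [Function.update_of_ne (Finset.ne_of_mem_erase hj), Finset.card_range]
  rw [hfin.encard_eq_coe_toFinset_card]
  have : hfin.toFinset.card * M j₀ ^ p ≤ (W + 1) * (∏ j, M j) ^ p := by
    rw [← hT, ← mul_assoc]
    gcongr
  exact_mod_cast this

theorem wordWeight_le_of_thin {J : Type*} [Fintype J] {M : J → ℕ} {R : ℕ} (hR : 0 < R)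
    (hM0 : ∀ j, 0 < M j) (j₀ : J) (hM : R ^ 2 ≤ M j₀) (W p : ℕ)
    (A : Set (List (∀ j, Fin (M j)))) (hlen : ∀ u ∈ A, u.length = p)
    (hthin : ∀ u ∈ A, ∀ v ∈ A, (∀ j, j ≠ j₀ → wordIdx u j = wordIdx v j) →
      wordIdx u j₀ ≤ wordIdx v j₀ + W) :
    wordWeight ((R : ℝ≥0∞) / (∏ j, M j : ℕ)) A ≤ (W + 1 : ℕ) * ((R : ℝ≥0∞)⁻¹) ^ p := by
  rw [wordWeight_eq_of_length _ A p hlen]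
  have h1 := encard_mul_le_of_thin j₀ W p A hlen hthin
  have hP : 0 < ∏ j, M j := Finset.prod_pos fun j _ => hM0 j
  obtain ⟨a, ha⟩ : ∃ a : ℕ, A.encard = a := by
    refine ⟨A.encard.toNat, (ENat.natCast_toNat ?_).symm⟩
    intro h
    rw [h, ENat.top_mul (by exact_mod_cast (pow_pos (hM0 j₀) p).ne')] at h1
    exact (ENat.natCast_ne_top _) (top_le_iff.1 h1)
  rw [ha] at h1 ⊢
  have h2 : a * M j₀ ^ p ≤ (W + 1) * (∏ j, M j) ^ p := by exact_mod_cast h1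
  have h3 : a * R ^ p * R ^ p ≤ (W + 1) * (∏ j, M j) ^ p := by
    refine le_trans ?_ h2
    rw [mul_assoc, ← mul_pow, ← sq]
    gcongr
  have h4 : (a : ℝ≥0∞) * (R : ℝ≥0∞) ^ p * (R : ℝ≥0∞) ^ p ≤
      (W + 1 : ℕ) * ((∏ j, M j : ℕ) : ℝ≥0∞) ^ p := by exact_mod_cast h3
  have hR' : (R : ℝ≥0∞) ≠ 0 := by exact_mod_cast hR.ne'
  rw [ENNReal.div_eq_inv_mul, mul_pow, ← ENNReal.inv_pow, ← ENNReal.inv_pow]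
  change (a : ℝ≥0∞) * _ ≤ _
  rw [← div_eq_mul_inv (a := ((W + 1 : ℕ) : ℝ≥0∞)),
    ENNReal.le_div_iff_mul_le (Or.inl (pow_ne_zero _ hR')) (Or.inl (by finiteness))]
  calc (a : ℝ≥0∞) * ((((∏ j, M j : ℕ) : ℝ≥0∞) ^ p)⁻¹ * (R : ℝ≥0∞) ^ p) * (R : ℝ≥0∞) ^ p
      = (a : ℝ≥0∞) * (R : ℝ≥0∞) ^ p * (R : ℝ≥0∞) ^ p / ((∏ j, M j : ℕ) : ℝ≥0∞) ^ p := by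
        rw [div_eq_mul_inv]; ring
    _ ≤ _ := ENNReal.div_le_of_le_mul h4

/-- Points in the boxes of two words of the same length. -/
theorem abs_sub_mul_le_of_mem_wordBox {J : Type*} {M : J → ℕ} {k l : List (∀ j, Fin (M j))}
    (hl : k.length = l.length) {s t : J → ℝ} (hs : s ∈ wordBox k) (ht : t ∈ wordBox l) {j : J}
    (h : wordIdx k j = wordIdx l j) : |s j - t j| * (M j : ℝ) ^ k.length ≤ 1 := by
  have h1 := hs j
  have h2 := ht j
  rw [← hl, ← h] at h2
  have hp : (0 : ℝ) ≤ (M j : ℝ) ^ k.length := by positivity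
  rw [← abs_of_nonneg hp, ← abs_mul, abs_le]
  constructor <;> nlinarith [h1.1, h1.2, h2.1, h2.2]

theorem wordIdx_le_of_mem_wordBox {J : Type*} {M : J → ℕ} {k l : List (∀ j, Fin (M j))}
    (hl : k.length = l.length) {s t : J → ℝ} (hs : s ∈ wordBox k) (ht : t ∈ wordBox l) {j : J}
    {C : ℝ} (h : |s j - t j| * (M j : ℝ) ^ k.length ≤ C) :
    (wordIdx k j : ℝ) ≤ wordIdx l j + C + 1 := by
  have h1 := hs j
  have h2 := ht j
  rw [← hl] at h2
  have hp : (0 : ℝ) ≤ (M j : ℝ) ^ k.length := by positivity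
  have h3 := mul_le_mul_of_nonneg_right (le_abs_self (s j - t j)) hp
  nlinarith [h1.1, h1.2, h2.1, h2.2]

theorem ncard_le_of_separated {ι : Type*} (F : Set ι) (f : ι → ℝ) {g P : ℝ} (hg : 0 < g)
    (hP : ∀ i ∈ F, |f i| ≤ P * g) (hsep : ∀ i ∈ F, ∀ j ∈ F, i ≠ j → g ≤ |f i - f j|) :
    F.Finite ∧ F.ncard ≤ (2 * ⌈P⌉ + 2).toNat := by
  set T : Finset ℤ := Finset.Icc (-⌈P⌉ - 1) ⌈P⌉ with hT
  have hmaps : ∀ i ∈ F, ⌊f i / g⌋ ∈ T := by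
    intro i hi
    have h1 := abs_le.1 (hP i hi)
    have h2 : f i / g ≤ P := (div_le_iff₀ hg).2 h1.2
    have h3 : -P ≤ f i / g := (le_div_iff₀ hg).2 (by linarith [h1.1])
    have h4 := Int.le_ceil P
    rw [hT, Finset.mem_Icc]
    constructor
    · rw [Int.le_floor]; push_cast; linarith
    · have := Int.floor_le (f i / g)
      exact_mod_cast this.trans (h2.trans h4)
  have hinj : Set.InjOn (fun i => ⌊f i / g⌋) F := by
    intro i hi j hj h
    by_contra hne
    have h1 := hsep i hi j hj hne
    have h2 : |f i / g - f j / g| < 1 := Int.abs_sub_lt_one_of_floor_eq_floor h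
    rw [← sub_div, abs_div, abs_of_pos hg, div_lt_one hg] at h2
    linarith
  refine ⟨Set.Finite.of_injOn hmaps hinj T.finite_toSet, ?_⟩
  have h1 := Set.ncard_le_ncard_of_injOn _ hmaps hinj T.finite_toSet
  rw [Set.ncard_coe_finset, hT, Int.card_Icc] at h1
  refine h1.trans (le_of_eq ?_)
  congr 1
  ring

/-- A chart for inhomogeneous forms: in the coordinates `crd`, the slopes are `a`, `b` and
the translations are `x`, `y`. -/
structure FormChart {J : Type*} (M : J → ℕ) (N : ℕ) where
  (a b x y : J)
  (cen : J → ℝ)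
  (ρ κ L Y : ℝ)
  base_a : M a = N ^ 2
  base_b : M b = N ^ 2
  base_x : M x = N
  base_y : M y = N
  a_ne_x : a ≠ x
  b_ne_x : b ≠ x
  a_ne_y : a ≠ y
  b_ne_y : b ≠ y
  x_ne_y : x ≠ y
  one_lt : 1 < N
  ρ_pos : 0 < ρ
  ρ_le : 3 * ρ < 1
  κ_pos : 0 < κ
  κ_le_one : κ ≤ 1
  Y_nonneg : 0 ≤ Y
  small : (2 + Y / κ) * ρ ≤ κ / 8
  κ_le : ∀ t ∈ wordBox (M := M) [], κ ≤ |(cen a + ρ * t a) - (cen b + ρ * t b)|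
  le_L : ∀ t ∈ wordBox (M := M) [], |(cen a + ρ * t a) - (cen b + ρ * t b)| ≤ L
  le_Y : ∀ t ∈ wordBox (M := M) [], |(cen x + ρ * t x) - (cen y + ρ * t y)| ≤ Y

namespace FormChart

variable {J : Type*} {M : J → ℕ} {N : ℕ} (P : FormChart M N)

/-- The affine coordinates of the chart. -/
def crd (t : J → ℝ) (j : J) : ℝ := P.cen j + P.ρ * t j

/-- The first inhomogeneous form. -/
def form₁ (t : J → ℝ) (m : ℤ × ℤ) : ℝ := P.crd t P.a * m.1 + m.2 + P.crd t P.x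

/-- The second inhomogeneous form. -/
def form₂ (t : J → ℝ) (m : ℤ × ℤ) : ℝ := P.crd t P.b * m.1 + m.2 + P.crd t P.y

/-- Exchanging the two forms. -/
abbrev swap : FormChart M N where
  a := P.b
  b := P.a
  x := P.y
  y := P.x
  cen := P.cen
  ρ := P.ρ
  κ := P.κ
  L := P.L
  Y := P.Y
  base_a := P.base_b
  base_b := P.base_a
  base_x := P.base_y
  base_y := P.base_x
  a_ne_x := P.b_ne_y
  b_ne_x := P.a_ne_y
  a_ne_y := P.b_ne_x
  b_ne_y := P.a_ne_x
  x_ne_y := P.x_ne_y.symm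
  one_lt := P.one_lt
  ρ_pos := P.ρ_pos
  ρ_le := P.ρ_le
  κ_pos := P.κ_pos
  κ_le_one := P.κ_le_one
  Y_nonneg := P.Y_nonneg
  small := P.small
  κ_le := fun t ht => by rw [abs_sub_comm]; exact P.κ_le t ht
  le_L := fun t ht => by rw [abs_sub_comm]; exact P.le_L t ht
  le_Y := fun t ht => by rw [abs_sub_comm]; exact P.le_Y t ht

/-- The slope `a` is badly approximable on the box of `k`, up to the scale of `k`. -/
def BadlyApprox (k : List (∀ j, Fin (M j))) : Prop :=
  ∀ t ∈ wordBox k, ∀ q p : ℤ, q ≠ 0 → |(q : ℝ)| * N ≤ (N : ℝ) ^ k.length →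
    P.ρ < |q * P.crd t P.a + p| * |(q : ℝ)| * (N : ℝ) ^ 4

/-- At `t`, the product of the forms at `m` is close to the normalized value `τ`, with the
second form of size about `N ^ n`. -/
structure Close (τ c δ : ℝ) (n : ℕ) (t : J → ℝ) (m : ℤ × ℤ) : Prop where
  le : |P.form₁ t m| ≤ |P.form₂ t m|
  lower : c * (N : ℝ) ^ n ≤ |P.form₂ t m|
  upper : |P.form₂ t m| ≤ P.κ / (8 * N) * (N : ℝ) ^ n
  close : |P.form₁ t m * P.form₂ t m - τ * (P.crd t P.a - P.crd t P.b)| ≤ δ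

/-- The extensions of `k` by `p` letters whose box meets a neighbourhood of the curves
`form₁ * form₂ = τ * (a - b)`. -/
def curveWords (τ c : ℝ) (p : ℕ) (k : List (∀ j, Fin (M j))) : Set (List (∀ j, Fin (M j))) :=
  {v | P.BadlyApprox k ∧ 1 ≤ k.length ∧ ∃ u : List (∀ j, Fin (M j)), u.length = p ∧
    v = u ++ k ∧ ∃ t ∈ wordBox v, ∃ m, P.Close τ c (((N : ℝ) ^ p)⁻¹) k.length t m}

variable {P}

theorem abs_crd_sub_mul_le {k l : List (∀ j, Fin (M j))} (hl : k.length = l.length)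
    {s t : J → ℝ} (hs : s ∈ wordBox k) (ht : t ∈ wordBox l) {j : J}
    (h : wordIdx k j = wordIdx l j) :
    |P.crd s j - P.crd t j| * (M j : ℝ) ^ k.length ≤ P.ρ := by
  have h1 := abs_sub_mul_le_of_mem_wordBox hl hs ht h
  have h2 : P.crd s j - P.crd t j = P.ρ * (s j - t j) := by unfold crd; ring
  rw [h2, abs_mul, abs_of_pos P.ρ_pos, mul_assoc]
  exact mul_le_of_le_one_right P.ρ_pos.le h1

theorem base_pow_pos (P : FormChart M N) (n : ℕ) : (0 : ℝ) < (N : ℝ) ^ n := by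
  have := P.one_lt
  positivity

theorem one_le_base_pow (P : FormChart M N) (n : ℕ) : (1 : ℝ) ≤ (N : ℝ) ^ n :=
  one_le_pow₀ (by exact_mod_cast P.one_lt.le)

theorem form₁_sub_form₂ (P : FormChart M N) (t : J → ℝ) (m : ℤ × ℤ) :
    P.form₁ t m - P.form₂ t m =
      (P.crd t P.a - P.crd t P.b) * m.1 + (P.crd t P.x - P.crd t P.y) := by
  unfold form₁ form₂; ring

theorem Close.abs_fst_le {τ c δ : ℝ} {n : ℕ} {t : J → ℝ} {m : ℤ × ℤ}
    (h : P.Close τ c δ n t m) (ht : t ∈ wordBox (M := M) []) :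
    |(m.1 : ℝ)| ≤ (1 + P.Y / P.κ) * (N : ℝ) ^ n := by
  have h1 := P.form₁_sub_form₂ t m
  have h2 := P.κ_le t ht
  have h3 := P.le_Y t ht
  change P.κ ≤ |P.crd t P.a - P.crd t P.b| at h2
  change |P.crd t P.x - P.crd t P.y| ≤ P.Y at h3
  have hκ := P.κ_pos
  have hN : (1 : ℝ) ≤ N := by exact_mod_cast P.one_lt.le
  have h4 : |P.crd t P.a - P.crd t P.b| * |(m.1 : ℝ)| ≤
      |P.form₁ t m| + |P.form₂ t m| + P.Y := by
    rw [← abs_mul]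
    have : (P.crd t P.a - P.crd t P.b) * m.1 =
        P.form₁ t m - P.form₂ t m - (P.crd t P.x - P.crd t P.y) := by rw [h1]; ring
    rw [this]
    have := abs_sub (P.form₁ t m - P.form₂ t m) (P.crd t P.x - P.crd t P.y)
    have := abs_sub (P.form₁ t m) (P.form₂ t m)
    linarith
  have h5 : P.κ * |(m.1 : ℝ)| ≤ |P.crd t P.a - P.crd t P.b| * |(m.1 : ℝ)| := by gcongr
  have h6 : P.κ / (8 * N) * (N : ℝ) ^ n ≤ P.κ / 2 * (N : ℝ) ^ n := by
    have := P.base_pow_pos n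
    gcongr
    linarith
  have h7 := h.le
  have h8 := h.upper
  have h9 := P.one_le_base_pow n
  have h10 : P.Y * 1 ≤ P.Y * (N : ℝ) ^ n := by
    have := P.Y_nonneg
    gcongr
  rw [← mul_le_mul_iff_right₀ hκ]
  calc P.κ * |(m.1 : ℝ)| ≤ P.κ * (N : ℝ) ^ n + P.Y * (N : ℝ) ^ n := by linarith
    _ = _ := by field_simp

theorem Close.abs_form₁_mul_le {τ c δ : ℝ} (hc : 0 < c) (hδ : δ ≤ 1) {n : ℕ} {t : J → ℝ}
    {m : ℤ × ℤ} (h : P.Close τ c δ n t m) (ht : t ∈ wordBox (M := M) []) :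
    |P.form₁ t m| * (N : ℝ) ^ n ≤ (|τ| * P.L + 1) / c := by
  rw [le_div_iff₀ hc]
  have h1 := P.le_L t ht
  change |P.crd t P.a - P.crd t P.b| ≤ P.L at h1
  have h2 : |P.form₁ t m * P.form₂ t m| ≤ |τ| * P.L + 1 := by
    have h3 := abs_add_le (P.form₁ t m * P.form₂ t m - τ * (P.crd t P.a - P.crd t P.b))
      (τ * (P.crd t P.a - P.crd t P.b))
    rw [sub_add_cancel, abs_mul τ] at h3
    have h4 : |τ| * |P.crd t P.a - P.crd t P.b| ≤ |τ| * P.L := by gcongr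
    linarith [h.close]
  rw [abs_mul] at h2
  calc |P.form₁ t m| * (N : ℝ) ^ n * c = |P.form₁ t m| * (c * (N : ℝ) ^ n) := by ring
    _ ≤ |P.form₁ t m| * |P.form₂ t m| := by gcongr; exact h.lower
    _ ≤ _ := h2

theorem abs_form₁_sub_mul_le {k : List (∀ j, Fin (M j))} {s t : J → ℝ}
    (hs : s ∈ wordBox k) (ht : t ∈ wordBox k) {m : ℤ × ℤ} {Λ : ℝ}
    (hm : |(m.1 : ℝ)| ≤ Λ * (N : ℝ) ^ k.length) :
    |P.form₁ s m - P.form₁ t m| * (N : ℝ) ^ k.length ≤ (Λ + 1) * P.ρ := by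
  have h1 := abs_crd_sub_mul_le (P := P) rfl hs ht (j := P.a) rfl
  have h2 := abs_crd_sub_mul_le (P := P) rfl hs ht (j := P.x) rfl
  rw [P.base_a] at h1
  rw [P.base_x] at h2
  push_cast at h1
  rw [← pow_mul, mul_comm 2, pow_mul] at h1
  have hp := P.base_pow_pos k.length
  set X : ℝ := (N : ℝ) ^ k.length
  have h3 : P.form₁ s m - P.form₁ t m =
      (P.crd s P.a - P.crd t P.a) * m.1 + (P.crd s P.x - P.crd t P.x) := by
    unfold form₁; ring
  have hΛ : 0 ≤ Λ := by
    have := (abs_nonneg (m.1 : ℝ)).trans hm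
    exact nonneg_of_mul_nonneg_left this hp
  calc |P.form₁ s m - P.form₁ t m| * X
      ≤ (|P.crd s P.a - P.crd t P.a| * |(m.1 : ℝ)| + |P.crd s P.x - P.crd t P.x|) * X := by
        rw [h3, ← abs_mul]; gcongr; exact abs_add_le _ _
    _ ≤ (|P.crd s P.a - P.crd t P.a| * (Λ * X) + |P.crd s P.x - P.crd t P.x|) * X := by gcongr
    _ = Λ * (|P.crd s P.a - P.crd t P.a| * X ^ 2) + |P.crd s P.x - P.crd t P.x| * X := by ring
    _ ≤ Λ * P.ρ + P.ρ := by gcongr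
    _ = _ := by ring

theorem abs_form₂_sub_mul_le {k : List (∀ j, Fin (M j))} {s t : J → ℝ}
    (hs : s ∈ wordBox k) (ht : t ∈ wordBox k) {m : ℤ × ℤ} {Λ : ℝ}
    (hm : |(m.1 : ℝ)| ≤ Λ * (N : ℝ) ^ k.length) :
    |P.form₂ s m - P.form₂ t m| * (N : ℝ) ^ k.length ≤ (Λ + 1) * P.ρ :=
  abs_form₁_sub_mul_le (P := P.swap) hs ht hm

theorem BadlyApprox.separated {k : List (∀ j, Fin (M j))} (hk : P.BadlyApprox k)
    (hk1 : 1 ≤ k.length) {t₀ : J → ℝ} (ht₀ : t₀ ∈ wordBox k) {m m' : ℤ × ℤ} (hne : m ≠ m')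
    {V : ℝ} (hV : V * (8 * N) ≤ P.κ * (N : ℝ) ^ k.length)
    (h₁ : |P.form₁ t₀ m| ≤ V + P.κ / 8 * ((N : ℝ) ^ k.length)⁻¹)
    (h₁' : |P.form₁ t₀ m'| ≤ V + P.κ / 8 * ((N : ℝ) ^ k.length)⁻¹)
    (h₂ : |P.form₂ t₀ m| ≤ V + P.κ / 8 * ((N : ℝ) ^ k.length)⁻¹)
    (h₂' : |P.form₂ t₀ m'| ≤ V + P.κ / 8 * ((N : ℝ) ^ k.length)⁻¹) :
    P.ρ / (N : ℝ) ^ 4 * ((N : ℝ) ^ k.length)⁻¹ ≤ |P.form₁ t₀ m - P.form₁ t₀ m'| := by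
  have hN : (1 : ℝ) < N := by exact_mod_cast P.one_lt
  have hX := P.one_le_base_pow k.length
  have hXN : (N : ℝ) ≤ (N : ℝ) ^ k.length := le_self_pow₀ hN.le (by omega)
  have hκ := P.κ_pos
  have ht0 : t₀ ∈ wordBox (M := M) [] := wordBox_antitone (List.nil_suffix) ht₀
  have hd : P.form₁ t₀ m - P.form₁ t₀ m' =
      (m.1 - m'.1 : ℤ) * P.crd t₀ P.a + (m.2 - m'.2 : ℤ) := by
    unfold form₁; push_cast; ring
  have hsmall : P.ρ / (N : ℝ) ^ 4 * ((N : ℝ) ^ k.length)⁻¹ ≤ 1 := by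
    refine mul_le_one₀ ?_ (by positivity) (inv_le_one_of_one_le₀ hX)
    rw [div_le_one (by positivity)]
    have := P.one_le_base_pow 4
    have := P.ρ_le
    linarith
  by_cases hq : m.1 - m'.1 = 0
  · have hp : m.2 - m'.2 ≠ 0 := fun h => hne (Prod.ext (by omega) (by omega))
    rw [hd, hq]
    simp only [Int.cast_zero, zero_mul, zero_add]
    refine hsmall.trans ?_
    exact_mod_cast Int.one_le_abs hp
  · have hκt := P.κ_le t₀ ht0
    change P.κ ≤ |P.crd t₀ P.a - P.crd t₀ P.b| at hκt
    set X : ℝ := (N : ℝ) ^ k.length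
    have hXi : X⁻¹ * N ≤ X := by
      rw [inv_mul_le_iff₀ (by linarith)]
      nlinarith
    have hb : P.κ * |((m.1 - m'.1 : ℤ) : ℝ)| ≤ 4 * V + P.κ / 2 * X⁻¹ := by
      have e1 := P.form₁_sub_form₂ t₀ m
      have e2 := P.form₁_sub_form₂ t₀ m'
      have e3 : (P.crd t₀ P.a - P.crd t₀ P.b) * (m.1 - m'.1 : ℤ) =
          (P.form₁ t₀ m - P.form₂ t₀ m) - (P.form₁ t₀ m' - P.form₂ t₀ m') := by
        rw [e1, e2]; push_cast; ring
      calc P.κ * |((m.1 - m'.1 : ℤ) : ℝ)|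
          ≤ |P.crd t₀ P.a - P.crd t₀ P.b| * |((m.1 - m'.1 : ℤ) : ℝ)| := by gcongr
        _ = |(P.form₁ t₀ m - P.form₂ t₀ m) - (P.form₁ t₀ m' - P.form₂ t₀ m')| := by
            rw [← abs_mul, e3]
        _ ≤ _ := by
            have i1 := abs_sub (P.form₁ t₀ m - P.form₂ t₀ m) (P.form₁ t₀ m' - P.form₂ t₀ m')
            have i2 := abs_sub (P.form₁ t₀ m) (P.form₂ t₀ m)
            have i3 := abs_sub (P.form₁ t₀ m') (P.form₂ t₀ m')
            linarith
    have hqN : |((m.1 - m'.1 : ℤ) : ℝ)| * N ≤ X := by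
      rw [← mul_le_mul_iff_right₀ hκ]
      have j1 : P.κ * |((m.1 - m'.1 : ℤ) : ℝ)| * N ≤ (4 * V + P.κ / 2 * X⁻¹) * N := by gcongr
      have j2 : P.κ / 2 * (X⁻¹ * N) ≤ P.κ / 2 * X := by gcongr
      linarith
    have hba := hk t₀ ht₀ _ (m.2 - m'.2) hq hqN
    rw [← hd] at hba
    have hq1 : |((m.1 - m'.1 : ℤ) : ℝ)| ≤ X := by
      refine le_trans ?_ hqN
      exact le_mul_of_one_le_right (abs_nonneg _) hN.le
    rw [div_mul_eq_mul_div, div_le_iff₀ (by positivity), ← div_eq_mul_inv,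
      div_le_iff₀ (by linarith)]
    calc P.ρ ≤ |P.form₁ t₀ m - P.form₁ t₀ m'| * |((m.1 - m'.1 : ℤ) : ℝ)| * (N : ℝ) ^ 4 := hba.le
      _ ≤ |P.form₁ t₀ m - P.form₁ t₀ m'| * X * (N : ℝ) ^ 4 := by gcongr
      _ = _ := by ring

end FormChart

theorem wordWeight_biUnion_le {D ι : Type*} (w : ℝ≥0∞) {F : Set ι} (hF : F.Finite) {n : ℕ}
    (hn : F.ncard ≤ n) (A : ι → Set (List D)) {r : ℝ≥0∞} (h : ∀ i ∈ F, wordWeight w (A i) ≤ r) :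
    wordWeight w (⋃ i ∈ F, A i) ≤ n * r := by
  rw [Set.biUnion_eq_iUnion]
  refine (wordWeight_iUnion_le w _).trans ?_
  refine (ENNReal.tsum_le_tsum fun i : F => h i i.2).trans ?_
  rw [ENNReal.tsum_const]
  gcongr
  have : ENat.card F = (F.ncard : ℕ∞) := by
    rw [hF.cast_ncard_eq]; rfl
  rw [this]
  exact_mod_cast hn

namespace FormChart

variable {J : Type*} {M : J → ℕ} {N : ℕ} {P : FormChart M N}

theorem BadlyApprox.ncard_close_le (hM : ∀ j, 0 < M j) {k : List (∀ j, Fin (M j))}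
    (hk : P.BadlyApprox k) (hk1 : 1 ≤ k.length) {τ c : ℝ} (hc : 0 < c) :
    {m | ∃ t ∈ wordBox k, P.Close τ c 1 k.length t m}.Finite ∧
    {m | ∃ t ∈ wordBox k, P.Close τ c 1 k.length t m}.ncard ≤
      (2 * ⌈((|τ| * P.L + 1) / c + P.κ / 8) / (P.ρ / (N : ℝ) ^ 4)⌉ + 2).toNat := by
  set t₀ : J → ℝ := fun j => wordIdx k j / (M j : ℝ) ^ k.length with ht₀
  have ht₀k : t₀ ∈ wordBox k := wordBox_nonempty_corner hM k
  have hX := P.one_le_base_pow k.length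
  have hρ := P.ρ_pos
  have hN : (1 : ℝ) < N := by exact_mod_cast P.one_lt
  have key : ∀ m, (∃ t ∈ wordBox k, P.Close τ c 1 k.length t m) → ∃ t ∈ wordBox k,
      P.Close τ c 1 k.length t m ∧
      |P.form₁ t₀ m| ≤ |P.form₁ t m| + P.κ / 8 * ((N : ℝ) ^ k.length)⁻¹ ∧
      |P.form₂ t₀ m| ≤ |P.form₂ t m| + P.κ / 8 * ((N : ℝ) ^ k.length)⁻¹ := by
    rintro m ⟨t, ht, h⟩
    have ht0 : t ∈ wordBox (M := M) [] := wordBox_antitone (List.nil_suffix) ht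
    have h1 := abs_form₁_sub_mul_le (P := P) ht₀k ht (h.abs_fst_le ht0)
    have h2 := abs_form₂_sub_mul_le (P := P) ht₀k ht (h.abs_fst_le ht0)
    have h3 : (1 + P.Y / P.κ + 1) * P.ρ ≤ P.κ / 8 := by
      have := P.small
      linarith
    replace h1 := h1.trans h3
    replace h2 := h2.trans h3
    rw [← le_div_iff₀ (by linarith), div_eq_mul_inv] at h1 h2
    refine ⟨t, ht, h, ?_, ?_⟩
    · have := abs_add_le (P.form₁ t₀ m - P.form₁ t m) (P.form₁ t m)
      rw [sub_add_cancel] at this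
      linarith
    · have := abs_add_le (P.form₂ t₀ m - P.form₂ t m) (P.form₂ t m)
      rw [sub_add_cancel] at this
      linarith
  refine ncard_le_of_separated _ (fun m => P.form₁ t₀ m)
    (g := P.ρ / (N : ℝ) ^ 4 * ((N : ℝ) ^ k.length)⁻¹) (by positivity) ?_ ?_
  · intro m hm
    obtain ⟨t, ht, h, h1, -⟩ := key m hm
    have h2 := h.abs_form₁_mul_le hc le_rfl (wordBox_antitone (List.nil_suffix) ht)
    rw [← le_div_iff₀ (by linarith), div_eq_mul_inv] at h2
    rw [← mul_assoc, div_mul_cancel₀ _ (by positivity)]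
    linarith
  · intro m hm m' hm' hne
    obtain ⟨t, ht, h, h1, h2⟩ := key m hm
    obtain ⟨t', ht', h', h1', h2'⟩ := key m' hm'
    have a1 := h.le
    have a2 := h.upper
    have a1' := h'.le
    have a2' := h'.upper
    refine hk.separated hk1 ht₀k hne (V := P.κ / (8 * N) * (N : ℝ) ^ k.length) (le_of_eq ?_)
      ?_ ?_ ?_ ?_
    · field_simp
    all_goals linarith

/-- For a single `m`, the words whose box is close to the curve form a thin set. -/
theorem exists_thin_bound (P : FormChart M N) {τ c : ℝ} (hc : 0 < c) :
    ∃ W : ℕ, ∀ (p : ℕ) (k u u' : List (∀ j, Fin (M j))) (m : ℤ × ℤ), u.length = p →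
      u'.length = p →
      (∃ t ∈ wordBox (u ++ k), P.Close τ c (((N : ℝ) ^ p)⁻¹) k.length t m) →
      (∃ t ∈ wordBox (u' ++ k), P.Close τ c (((N : ℝ) ^ p)⁻¹) k.length t m) →
      (∀ j, j ≠ P.x → wordIdx u j = wordIdx u' j) → wordIdx u P.x ≤ wordIdx u' P.x + W := by
  set Λ : ℝ := 1 + P.Y / P.κ with hΛ
  set Q : ℝ := (|τ| * P.L + 1) / c with hQ
  set V : ℝ := (2 + 2 * |τ| * P.ρ + Q * ((Λ + 1) * P.ρ)) / c + Λ * P.ρ with hV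
  refine ⟨⌈V / P.ρ⌉₊ + 1, ?_⟩
  rintro p k u u' m hu hu' ⟨t, ht, h⟩ ⟨t', ht', h'⟩ hidx
  have hρ := P.ρ_pos
  have hκ := P.κ_pos
  have hlen : (u ++ k).length = (u' ++ k).length := by simp [hu, hu']
  have hlen' : (u ++ k).length = p + k.length := by simp [hu]
  have hidx' : ∀ j, j ≠ P.x → wordIdx (u ++ k) j = wordIdx (u' ++ k) j := fun j hj => by
    rw [wordIdx_append, wordIdx_append, hidx j hj, hu, hu']
  have ha := abs_crd_sub_mul_le (P := P) hlen ht ht' (hidx' P.a P.a_ne_x)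
  have hb := abs_crd_sub_mul_le (P := P) hlen ht ht' (hidx' P.b P.b_ne_x)
  have hy := abs_crd_sub_mul_le (P := P) hlen ht ht' (hidx' P.y P.x_ne_y.symm)
  rw [P.base_a, hlen'] at ha
  rw [P.base_b, hlen'] at hb
  rw [P.base_y, hlen'] at hy
  push_cast at ha hb
  rw [← pow_mul, mul_comm 2, pow_mul] at ha hb
  have ht0 : t ∈ wordBox (M := M) [] := wordBox_antitone (List.nil_suffix) ht
  have ht0' : t' ∈ wordBox (M := M) [] := wordBox_antitone (List.nil_suffix) ht'
  have hδ : (((N : ℝ) ^ p)⁻¹) ≤ 1 := inv_le_one_of_one_le₀ (P.one_le_base_pow p)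
  have hm := h.abs_fst_le ht0
  have hf := h'.abs_form₁_mul_le hc hδ ht0'
  have hlow := h.lower
  have hcl := h.close
  have hcl' := h'.close
  rw [← hΛ] at hm
  rw [← hQ] at hf
  have hX1 := P.one_le_base_pow k.length
  have hZ1 := P.one_le_base_pow p
  have hΛ0 : 0 ≤ Λ := by have := P.Y_nonneg; positivity
  rw [pow_add] at ha hb hy
  have hlast : |P.crd t P.x - P.crd t' P.x| * ((N : ℝ) ^ p * (N : ℝ) ^ k.length) ≤ V →
      wordIdx u P.x ≤ wordIdx u' P.x + (⌈V / P.ρ⌉₊ + 1) := by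
    intro hD
    have e : P.crd t P.x - P.crd t' P.x = P.ρ * (t P.x - t' P.x) := by unfold crd; ring
    have h1 : |t P.x - t' P.x| * (M P.x : ℝ) ^ (u ++ k).length ≤ V / P.ρ := by
      rw [le_div_iff₀ hρ, P.base_x, hlen', pow_add]
      rw [e, abs_mul, abs_of_pos hρ] at hD
      linarith
    have h2 := wordIdx_le_of_mem_wordBox hlen ht ht' h1
    rw [wordIdx_append, wordIdx_append, hu, hu'] at h2
    push_cast at h2
    have h3 := Nat.le_ceil (V / P.ρ)
    have h4 : (wordIdx u P.x : ℝ) ≤ wordIdx u' P.x + (⌈V / P.ρ⌉₊ + 1) := by linarith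
    exact_mod_cast h4
  refine hlast ?_
  set X : ℝ := (N : ℝ) ^ k.length
  set Z : ℝ := (N : ℝ) ^ p
  set G := P.form₁ t m * P.form₂ t m - τ * (P.crd t P.a - P.crd t P.b) with hG
  set G' := P.form₁ t' m * P.form₂ t' m - τ * (P.crd t' P.a - P.crd t' P.b) with hG'
  have hZ0 : 0 < Z := by linarith
  have hGZ : |G| * Z ≤ 1 := by
    rw [← le_div_iff₀ hZ0, one_div]; exact hcl
  have hGZ' : |G'| * Z ≤ 1 := by
    rw [← le_div_iff₀ hZ0, one_div]; exact hcl'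
  have hsq : ∀ r : ℝ, r * (Z * X) ^ 2 ≤ P.ρ → 0 ≤ r → r * (Z * X ^ 2) ≤ P.ρ := by
    intro r hr hr0
    refine le_trans ?_ hr
    rw [mul_pow]
    gcongr
    exact le_self_pow₀ hZ1 two_ne_zero
  have ha' := hsq _ ha (abs_nonneg _)
  have hb' := hsq _ hb (abs_nonneg _)
  have hlow1 : ∀ r : ℝ, r * (Z * X ^ 2) ≤ P.ρ → 0 ≤ r → r * Z ≤ P.ρ := by
    intro r hr hr0
    refine le_trans ?_ hr
    rw [← mul_assoc]
    exact le_mul_of_one_le_right (by positivity) (one_le_pow₀ hX1)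
  have hQ0 : 0 ≤ Q := le_trans (by positivity) hf
  have hf2 : |P.form₂ t m - P.form₂ t' m| * (Z * X) ≤ (Λ + 1) * P.ρ := by
    have e : P.form₂ t m - P.form₂ t' m =
        (P.crd t P.b - P.crd t' P.b) * m.1 + (P.crd t P.y - P.crd t' P.y) := by
      unfold form₂; ring
    calc |P.form₂ t m - P.form₂ t' m| * (Z * X)
        ≤ (|P.crd t P.b - P.crd t' P.b| * |(m.1 : ℝ)| + |P.crd t P.y - P.crd t' P.y|) *
          (Z * X) := by
          rw [e, ← abs_mul]; gcongr; exact abs_add_le _ _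
      _ ≤ (|P.crd t P.b - P.crd t' P.b| * (Λ * X) + |P.crd t P.y - P.crd t' P.y|) *
          (Z * X) := by gcongr
      _ = Λ * (|P.crd t P.b - P.crd t' P.b| * (Z * X ^ 2)) +
          |P.crd t P.y - P.crd t' P.y| * (Z * X) := by ring
      _ ≤ Λ * P.ρ + P.ρ := by gcongr
      _ = _ := by ring
  have hv : |P.form₁ t m - P.form₁ t' m| * (Z * X) ≤
      (2 + 2 * |τ| * P.ρ + Q * ((Λ + 1) * P.ρ)) / c := by
    rw [le_div_iff₀ hc]
    have e : (P.form₁ t m - P.form₁ t' m) * P.form₂ t m = (G - G') +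
        τ * ((P.crd t P.a - P.crd t' P.a) - (P.crd t P.b - P.crd t' P.b)) -
        P.form₁ t' m * (P.form₂ t m - P.form₂ t' m) := by
      rw [hG, hG']; ring
    calc |P.form₁ t m - P.form₁ t' m| * (Z * X) * c
        = |P.form₁ t m - P.form₁ t' m| * (c * X) * Z := by ring
      _ ≤ |P.form₁ t m - P.form₁ t' m| * |P.form₂ t m| * Z := by gcongr
      _ = |(P.form₁ t m - P.form₁ t' m) * P.form₂ t m| * Z := by rw [abs_mul]
      _ ≤ ((|G| + |G'|) + |τ| * (|P.crd t P.a - P.crd t' P.a| + |P.crd t P.b - P.crd t' P.b|)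
          + |P.form₁ t' m| * |P.form₂ t m - P.form₂ t' m|) * Z := by
          rw [e]
          gcongr
          refine (abs_sub _ _).trans ?_
          rw [abs_mul (P.form₁ t' m)]
          gcongr
          refine (abs_add_le _ _).trans ?_
          rw [abs_mul τ]
          gcongr
          · exact abs_sub _ _
          · exact abs_sub _ _
      _ ≤ ((|G| + |G'|) + |τ| * (|P.crd t P.a - P.crd t' P.a| + |P.crd t P.b - P.crd t' P.b|))
          * Z + |P.form₁ t' m| * X * (|P.form₂ t m - P.form₂ t' m| * (Z * X)) := by
          rw [add_mul]
          refine add_le_add le_rfl ?_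
          have : |P.form₁ t' m| * X * (|P.form₂ t m - P.form₂ t' m| * (Z * X)) =
            |P.form₁ t' m| * |P.form₂ t m - P.form₂ t' m| * Z * X ^ 2 := by ring
          rw [this]
          exact le_mul_of_one_le_right (by positivity) (one_le_pow₀ hX1)
      _ = (|G| * Z + |G'| * Z) + |τ| * (|P.crd t P.a - P.crd t' P.a| * Z +
          |P.crd t P.b - P.crd t' P.b| * Z)
          + |P.form₁ t' m| * X * (|P.form₂ t m - P.form₂ t' m| * (Z * X)) := by ring
      _ ≤ (1 + 1) + |τ| * (P.ρ + P.ρ) + Q * ((Λ + 1) * P.ρ) := by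
          gcongr
          · exact hlow1 _ ha' (abs_nonneg _)
          · exact hlow1 _ hb' (abs_nonneg _)
      _ = _ := by ring
  have e : P.crd t P.x - P.crd t' P.x = (P.form₁ t m - P.form₁ t' m) -
      (P.crd t P.a - P.crd t' P.a) * m.1 := by
    unfold form₁; ring
  calc |P.crd t P.x - P.crd t' P.x| * (Z * X)
      ≤ (|P.form₁ t m - P.form₁ t' m| + |P.crd t P.a - P.crd t' P.a| * |(m.1 : ℝ)|) *
        (Z * X) := by
        rw [e, ← abs_mul]; gcongr; exact abs_sub _ _
    _ ≤ (|P.form₁ t m - P.form₁ t' m| + |P.crd t P.a - P.crd t' P.a| * (Λ * X)) *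
        (Z * X) := by gcongr
    _ = |P.form₁ t m - P.form₁ t' m| * (Z * X) +
        Λ * (|P.crd t P.a - P.crd t' P.a| * (Z * X ^ 2)) := by ring
    _ ≤ _ := by rw [hV]; gcongr

theorem exists_wordWeight_curveWords_le [Fintype J] (P : FormChart M N) {R : ℕ} (hR : 0 < R)
    (hRN : R ^ 2 ≤ N) (hM : ∀ j, 0 < M j) {τ c : ℝ} (hc : 0 < c) :
    ∃ C : ℕ, ∀ p k, wordWeight ((R : ℝ≥0∞) / (∏ j, M j : ℕ))
      {u | u ++ k ∈ P.curveWords τ c p k} ≤ C * ((R : ℝ≥0∞)⁻¹) ^ p := by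
  obtain ⟨W, hW⟩ := P.exists_thin_bound (τ := τ) hc
  set n := (2 * ⌈((|τ| * P.L + 1) / c + P.κ / 8) / (P.ρ / (N : ℝ) ^ 4)⌉ + 2).toNat with hn
  refine ⟨n * (W + 1), fun p k => ?_⟩
  by_cases hk : P.BadlyApprox k ∧ 1 ≤ k.length
  · obtain ⟨hfin, hcard⟩ := hk.1.ncard_close_le hM hk.2 hc (τ := τ)
    set A : ℤ × ℤ → Set (List (∀ j, Fin (M j))) := fun m =>
      {u | u.length = p ∧ ∃ t ∈ wordBox (u ++ k), P.Close τ c (((N : ℝ) ^ p)⁻¹) k.length t m}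
    have hA : ∀ m, wordWeight ((R : ℝ≥0∞) / (∏ j, M j : ℕ)) (A m) ≤
        (W + 1 : ℕ) * ((R : ℝ≥0∞)⁻¹) ^ p := fun m =>
      wordWeight_le_of_thin hR hM P.x (hRN.trans_eq P.base_x.symm) W p (A m) (fun u hu => hu.1)
        fun u hu v hv hidx => hW p k u v m hu.1 hv.1 hu.2 hv.2 hidx
    have hsub : {u | u ++ k ∈ P.curveWords τ c p k} ⊆
        ⋃ m ∈ {m | ∃ t ∈ wordBox k, P.Close τ c 1 k.length t m}, A m := by
      rintro u ⟨-, -, v, hv, huv, t, ht, m, hm⟩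
      obtain rfl := List.append_cancel_right huv
      refine Set.mem_biUnion (x := m) ⟨t, wordBox_antitone (List.suffix_append _ _) ht, ?_⟩
        ⟨hv, t, ht, hm⟩
      exact ⟨hm.le, hm.lower, hm.upper, hm.close.trans
        (inv_le_one_of_one_le₀ (P.one_le_base_pow p))⟩
    refine (wordWeight_mono _ hsub).trans ?_
    refine (wordWeight_biUnion_le _ hfin hcard A fun m _ => hA m).trans (le_of_eq ?_)
    push_cast
    ring
  · have : {u | u ++ k ∈ P.curveWords τ c p k} = ∅ := by
      ext u
      simp only [Set.mem_ofPred_eq, Set.mem_empty_iff_false, iff_false]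
      exact fun h => hk ⟨h.1, h.2.1⟩
    rw [this, wordWeight_eq_of_length _ ∅ 0 (by simp)]
    simp

/-- The one-letter extensions of `k` whose box meets a neighbourhood of a rational number of
small height, in the coordinate `a`. -/
def rationalWords (P : FormChart M N) (k : List (∀ j, Fin (M j))) :
    Set (List (∀ j, Fin (M j))) :=
  {v | ∃ d, v = d :: k ∧ ∃ t ∈ wordBox v, ∃ q p : ℤ, 1 ≤ q ∧ (q : ℝ) ≤ (N : ℝ) ^ k.length ∧
    |q * P.crd t P.a + p| * (N : ℝ) ^ (2 * k.length + 2) ≤ P.ρ * q}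

theorem wordWeight_rationalWords_le [Fintype J] (P : FormChart M N) {R : ℕ} (hR : 0 < R)
    (hRN : R ^ 2 ≤ N) (hM : ∀ j, 0 < M j) (k : List (∀ j, Fin (M j))) :
    wordWeight ((R : ℝ≥0∞) / (∏ j, M j : ℕ)) {u | u ++ k ∈ P.rationalWords k} ≤
      4 * (R : ℝ≥0∞)⁻¹ := by
  have hρ := P.ρ_pos
  have hN : (1 : ℝ) < N := by exact_mod_cast P.one_lt
  have hlen : ∀ u ∈ {u | u ++ k ∈ P.rationalWords k}, u.length = 1 := by
    rintro u ⟨d, hd, -⟩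
    have := congrArg List.length hd
    simp only [List.length_append, List.length_cons] at this
    omega
  have hM2 : R ^ 2 ≤ M P.a := by
    rw [P.base_a]
    exact hRN.trans (Nat.le_self_pow two_ne_zero N)
  refine (wordWeight_le_of_thin hR hM P.a hM2 3 1 _ hlen ?_).trans (by norm_num)
  intro u hu v hv hidx
  have hul := hlen u hu
  have hvl := hlen v hv
  obtain ⟨-, -, t, ht, q, p, hq1, hqN, hqp⟩ := hu
  obtain ⟨-, -, t', ht', q', p', hq1', hqN', hqp'⟩ := hv
  have hkt : t ∈ wordBox k := wordBox_antitone (List.suffix_append _ _) ht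
  have hkt' : t' ∈ wordBox k := wordBox_antitone (List.suffix_append _ _) ht'
  have hk := abs_crd_sub_mul_le (P := P) rfl hkt hkt' (j := P.a) rfl
  rw [P.base_a] at hk
  push_cast at hk
  rw [← pow_mul, mul_comm 2, pow_mul] at hk
  rw [pow_add, mul_comm 2, pow_mul] at hqp hqp'
  set X : ℝ := (N : ℝ) ^ k.length with hXdef
  have hq0 : (0 : ℝ) < q := by exact_mod_cast hq1
  have hq0' : (0 : ℝ) < q' := by exact_mod_cast hq1'
  have hnear : ∀ {s : J → ℝ} {a b : ℤ}, (0 : ℝ) < a →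
      |a * P.crd s P.a + b| * (X ^ 2 * (N : ℝ) ^ 2) ≤ P.ρ * a →
      |P.crd s P.a - (-b / a)| * (X ^ 2 * (N : ℝ) ^ 2) ≤ P.ρ := by
    intro s a b ha h
    have e : (a : ℝ) * P.crd s P.a + b = a * (P.crd s P.a - (-b / a)) := by
      field_simp; ring
    rw [e, abs_mul, abs_of_pos ha] at h
    refine le_of_mul_le_mul_left ?_ ha
    linarith
  have h1 := hnear hq0 hqp
  have h2 := hnear hq0' hqp'
  have hXN : ∀ {r : ℝ}, 0 ≤ r → r * (X ^ 2 * (N : ℝ) ^ 2) ≤ P.ρ → r * X ^ 2 ≤ P.ρ := by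
    intro r hr h
    refine le_trans ?_ h
    rw [← mul_assoc]
    exact le_mul_of_one_le_right (by positivity) (one_le_pow₀ hN.le)
  have h1' := hXN (abs_nonneg _) h1
  have h2' := hXN (abs_nonneg _) h2
  have hdiff : |(-p / q : ℝ) - (-p' / q')| * X ^ 2 ≤ 3 * P.ρ := by
    have e : (-p / q : ℝ) - (-p' / q') = (P.crd t P.a - P.crd t' P.a) -
      (P.crd t P.a - (-p / q)) + (P.crd t' P.a - (-p' / q')) := by ring
    have i1 := abs_add_le ((P.crd t P.a - P.crd t' P.a) - (P.crd t P.a - (-p / q)))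
      (P.crd t' P.a - (-p' / q'))
    have i2 := abs_sub (P.crd t P.a - P.crd t' P.a) (P.crd t P.a - (-p / q))
    rw [← e] at i1
    calc _ ≤ (|P.crd t P.a - P.crd t' P.a| + |P.crd t P.a - (-p / q)| +
        |P.crd t' P.a - (-p' / q')|) * X ^ 2 := by gcongr; linarith
      _ ≤ _ := by linarith
  have hint : |((p' * q - p * q' : ℤ) : ℝ)| < 1 := by
    have e : ((p' * q - p * q' : ℤ) : ℝ) = ((-p / q : ℝ) - (-p' / q')) * (q * q') := by
      push_cast; field_simp; ring
    rw [e, abs_mul, abs_of_pos (mul_pos hq0 hq0')]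
    calc |(-p / q : ℝ) - (-p' / q')| * (q * q') ≤ |(-p / q : ℝ) - (-p' / q')| * (X * X) := by
          gcongr
      _ = |(-p / q : ℝ) - (-p' / q')| * X ^ 2 := by ring
      _ ≤ 3 * P.ρ := hdiff
      _ < 1 := P.ρ_le
  have hz : p' * q - p * q' = 0 := by
    rw [← Int.abs_lt_one_iff]
    exact_mod_cast hint
  have heq : (-p / q : ℝ) = -p' / q' := by
    rw [div_eq_div_iff hq0.ne' hq0'.ne']
    have : (p' * q - p * q' : ℝ) = 0 := by exact_mod_cast hz
    linarith
  rw [← heq] at h2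
  have h3 : |t P.a - t' P.a| * (M P.a : ℝ) ^ (u ++ k).length ≤ 2 := by
    have e : P.crd t P.a - P.crd t' P.a = P.ρ * (t P.a - t' P.a) := by unfold crd; ring
    have e2 : (M P.a : ℝ) ^ (u ++ k).length = X ^ 2 * (N : ℝ) ^ 2 := by
      rw [P.base_a, List.length_append, hul, hXdef]
      push_cast
      ring
    rw [e2]
    have i1 := abs_sub (P.crd t P.a - (-p / q)) (P.crd t' P.a - (-p / q))
    rw [sub_sub_sub_cancel_right, e, abs_mul, abs_of_pos hρ] at i1
    refine le_of_mul_le_mul_left ?_ hρ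
    rw [← mul_assoc]
    calc P.ρ * |t P.a - t' P.a| * (X ^ 2 * (N : ℝ) ^ 2) ≤
        (|P.crd t P.a - (-p / q)| + |P.crd t' P.a - (-p / q)|) * (X ^ 2 * (N : ℝ) ^ 2) := by
          gcongr
      _ ≤ P.ρ * 2 := by linarith
  have h4 := wordIdx_le_of_mem_wordBox (by simp [hul, hvl]) ht ht' h3
  rw [wordIdx_append, wordIdx_append, hul, hvl] at h4
  push_cast at h4
  have h5 : (wordIdx u P.a : ℝ) ≤ wordIdx v P.a + 3 := by linarith
  exact_mod_cast h5

variable {ν : ℕ → List (∀ j, Fin (M j))}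

theorem suffix_of_le {D : Type*} {ν : ℕ → List D} (hsucc : ∀ n, ∃ d, ν (n + 1) = d :: ν n)
    {m n : ℕ} (h : m ≤ n) : ν m <:+ ν n := by
  induction n, h using Nat.le_induction with
  | base => exact List.suffix_rfl
  | succ n _ ih =>
    obtain ⟨d, hd⟩ := hsucc n
    rw [hd]
    exact ih.trans (List.suffix_cons _ _)

theorem badlyApprox_of_notMem (hlen : ∀ n, (ν n).length = n)
    (hsucc : ∀ n, ∃ d, ν (n + 1) = d :: ν n) (h : ∀ n, ν (n + 1) ∉ P.rationalWords (ν n))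
    (n : ℕ) : P.BadlyApprox (ν n) := by
  have hN : (1 : ℝ) < N := by exact_mod_cast P.one_lt
  have key : ∀ t ∈ wordBox (ν n), ∀ q p : ℤ, 1 ≤ q → (q : ℝ) * N ≤ (N : ℝ) ^ n →
      P.ρ < |q * P.crd t P.a + p| * (q : ℝ) * (N : ℝ) ^ 4 := by
    classical
    intro t ht q p hq hqn
    have hq1 : (1 : ℝ) ≤ q := by exact_mod_cast hq
    have hn : n ≠ 0 := by
      rintro rfl
      rw [pow_zero] at hqn
      nlinarith
    obtain ⟨n, rfl⟩ := Nat.exists_eq_succ_of_ne_zero hn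
    have hex : ∃ m, (q : ℝ) ≤ (N : ℝ) ^ m :=
      ⟨n, by rw [Nat.succ_eq_add_one, pow_succ] at hqn; exact le_of_mul_le_mul_right hqn (by linarith)⟩
    set m := Nat.find hex with hm
    have hmq : (q : ℝ) ≤ (N : ℝ) ^ m := Nat.find_spec hex
    have hmn : m ≤ n := Nat.find_min' hex (by
      rw [Nat.succ_eq_add_one, pow_succ] at hqn
      exact le_of_mul_le_mul_right hqn (by linarith))
    have hlow : (N : ℝ) ^ m ≤ q * N := by
      rcases Nat.eq_zero_or_pos m with h0 | h0
      · rw [h0, pow_zero]; nlinarith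
      · have := Nat.find_min hex (m := m - 1) (by omega)
        rw [not_le] at this
        have e : (N : ℝ) ^ m = (N : ℝ) ^ (m - 1) * N := by
          rw [← pow_succ]; congr 1; omega
        rw [e]
        gcongr
    have hnot := h m
    obtain ⟨d, hd⟩ := hsucc m
    have htm : t ∈ wordBox (ν (m + 1)) :=
      wordBox_antitone (suffix_of_le hsucc (by omega)) ht
    have hlt : P.ρ * q < |q * P.crd t P.a + p| * (N : ℝ) ^ (2 * m + 2) := by
      by_contra hcon
      rw [not_lt] at hcon
      exact hnot ⟨d, hd, t, htm, q, p, hq, by rwa [hlen], by rwa [hlen]⟩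
    have e : (N : ℝ) ^ (2 * m + 2) = ((N : ℝ) ^ m * N) ^ 2 := by ring
    refine lt_of_mul_lt_mul_right (a := (q : ℝ)) ?_ (by linarith)
    calc P.ρ * q < |q * P.crd t P.a + p| * (N : ℝ) ^ (2 * m + 2) := hlt
      _ ≤ |q * P.crd t P.a + p| * ((q * N) * N) ^ 2 := by rw [e]; gcongr
      _ = _ := by ring
  intro t ht q p hq0 hqn
  rw [hlen] at hqn
  rcases lt_or_gt_of_ne hq0 with hneg | hpos
  · have hq' : (q : ℝ) < 0 := by exact_mod_cast hneg
    rw [abs_of_neg hq'] at hqn ⊢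
    have := key t ht (-q) (-p) (by omega) (by push_cast; exact hqn)
    push_cast at this
    rw [show -(q : ℝ) * P.crd t P.a + -p = -(q * P.crd t P.a + p) by ring, abs_neg] at this
    exact this
  · have hq' : (0 : ℝ) < q := by exact_mod_cast hpos
    rw [abs_of_pos hq'] at hqn ⊢
    exact key t ht q p hpos hqn

theorem BadlyApprox.of_forall (hlen : ∀ n, (ν n).length = n) (h : ∀ n, P.BadlyApprox (ν n))
    {t : J → ℝ} (ht : ∀ n, t ∈ wordBox (ν n)) {q : ℤ} (hq : q ≠ 0) (p : ℤ) :
    P.ρ < |q * P.crd t P.a + p| * |(q : ℝ)| * (N : ℝ) ^ 4 := by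
  obtain ⟨n, hn⟩ := pow_unbounded_of_one_lt (|(q : ℝ)| * N) (by exact_mod_cast P.one_lt :
    (1 : ℝ) < N)
  exact h n t (ht n) q p hq (by rw [hlen]; exact hn.le)

/-- The admissible lower constant in `Close`. -/
noncomputable def lowerConst (P : FormChart M N) (τ : ℝ) : ℝ :=
  min (√(|τ| * P.κ / 2)) (P.κ / (8 * N)) / N

theorem lowerConst_pos (P : FormChart M N) {τ : ℝ} (hτ : τ ≠ 0) : 0 < P.lowerConst τ := by
  have := P.κ_pos
  have := P.one_lt
  have := abs_pos.2 hτ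
  unfold lowerConst
  positivity

theorem lt_abs_of_notMem_curveWords {τ : ℝ} (hlen : ∀ n, (ν n).length = n)
    (hsucc : ∀ n, ∃ d, ν (n + 1) = d :: ν n) (hba : ∀ n, P.BadlyApprox (ν n)) {p : ℕ}
    (h : ∀ n, ν (n + p) ∉ P.curveWords τ (P.lowerConst τ) p (ν n))
    {t : J → ℝ} (ht : ∀ n, t ∈ wordBox (ν n)) {m : ℤ × ℤ}
    (hm : |P.form₁ t m| ≤ |P.form₂ t m|) :
    min (((N : ℝ) ^ p)⁻¹) (|τ| * P.κ / 2) <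
      |P.form₁ t m * P.form₂ t m - τ * (P.crd t P.a - P.crd t P.b)| := by
  classical
  by_contra! hcon
  rw [le_min_iff] at hcon
  have hκ := P.κ_pos
  have hN : (1 : ℝ) < N := by exact_mod_cast P.one_lt
  set c := P.lowerConst τ with hc
  have hκt := P.κ_le t (wordBox_antitone (List.nil_suffix) (ht 0))
  change P.κ ≤ |P.crd t P.a - P.crd t P.b| at hκt
  have hs : √(|τ| * P.κ / 2) ≤ |P.form₂ t m| := by
    refine Real.sqrt_le_iff.2 ⟨abs_nonneg _, ?_⟩
    have h1 := abs_sub_abs_le_abs_sub (τ * (P.crd t P.a - P.crd t P.b))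
      (P.form₁ t m * P.form₂ t m)
    rw [abs_sub_comm, abs_mul, abs_mul] at h1
    have h2 : |τ| * P.κ ≤ |τ| * |P.crd t P.a - P.crd t P.b| := by gcongr
    have h3 : |P.form₁ t m| * |P.form₂ t m| ≤ |P.form₂ t m| * |P.form₂ t m| := by gcongr
    rw [sq]
    linarith [hcon.2]
  have hex : ∃ n, |P.form₂ t m| ≤ P.κ / (8 * N) * (N : ℝ) ^ (n + 1) := by
    obtain ⟨n, hn⟩ := pow_unbounded_of_one_lt (|P.form₂ t m| / (P.κ / (8 * N))) hN
    refine ⟨n, ?_⟩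
    rw [div_lt_iff₀' (by positivity)] at hn
    refine hn.le.trans ?_
    gcongr
    · exact hN.le
    · omega
  set n := Nat.find hex with hn
  have hup : |P.form₂ t m| ≤ P.κ / (8 * N) * (N : ℝ) ^ (n + 1) := Nat.find_spec hex
  have hlow : c * (N : ℝ) ^ (n + 1) ≤ |P.form₂ t m| := by
    have e : c * (N : ℝ) ^ (n + 1) =
        min (√(|τ| * P.κ / 2)) (P.κ / (8 * N)) * (N : ℝ) ^ n := by
      rw [hc, lowerConst, pow_succ]; field_simp
    rw [e]
    rcases Nat.eq_zero_or_pos n with h0 | h0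
    · rw [h0, pow_zero, mul_one]
      exact (min_le_left _ _).trans hs
    · have := Nat.find_min hex (m := n - 1) (by omega)
      rw [not_le, Nat.sub_add_cancel h0] at this
      refine le_trans ?_ this.le
      gcongr
      exact min_le_right _ _
  obtain ⟨u, hu⟩ := suffix_of_le hsucc (Nat.le_add_right (n + 1) p)
  refine h (n + 1) ⟨hba _, by rw [hlen]; omega, u, ?_, hu.symm, t, ht _, m, hm, ?_, ?_, hcon.1⟩
  · have := congrArg List.length hu
    rw [List.length_append, hlen, hlen] at this
    omega
  · rwa [hlen]
  · rwa [hlen]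

/-- There is a large tree all of whose limit points have badly approximable slopes and value
set staying away from each element of a countable set not containing `0`. -/
theorem exists_tree [Fintype J] (P : FormChart M N) {R : ℕ} (hR : 64 ≤ R) (hRN : R ^ 2 ≤ N)
    (hM : ∀ j, 0 < M j) {K : ℕ} (hK : K * R + 2 * ∏ j, M j ≤ R * ∏ j, M j)
    {B : Set ℝ} (hB : B.Countable) (h0 : (0 : ℝ) ∉ B) :
    ∃ S : Set (List (∀ j, Fin (M j))), [] ∈ S ∧ (∀ k ∈ S, K ≤ {d | d :: k ∈ S}.ncard) ∧
      ∀ t ∈ treeLimit S,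
        (∀ q p : ℤ, q ≠ 0 → P.ρ < |q * P.crd t P.a + p| * |(q : ℝ)| * (N : ℝ) ^ 4) ∧
        (∀ q p : ℤ, q ≠ 0 → P.ρ < |q * P.crd t P.b + p| * |(q : ℝ)| * (N : ℝ) ^ 4) ∧
        ∀ τ ∈ B, ∃ δ > 0, ∀ m,
          δ ≤ |P.form₁ t m * P.form₂ t m - τ * (P.crd t P.a - P.crd t P.b)| := by
  classical
  have := hB.to_subtype
  have hR0 : 0 < R := by omega
  set w : ℝ≥0∞ := (R : ℝ≥0∞) / (∏ j, M j : ℕ) with hw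
  have hRinv : (R : ℝ≥0∞)⁻¹ < 1 := ENNReal.inv_lt_one.2 (by exact_mod_cast (by omega : 1 < R))
  have hne : ∀ τ : B, (τ : ℝ) ≠ 0 := fun τ h => h0 (h ▸ τ.2)
  obtain ⟨ε, hε, hεsum⟩ := ENNReal.exists_pos_sum_of_countable' (ε := 1 / 8) (by simp) B
  have hpex : ∀ τ : B, ∃ p : ℕ, ∀ k,
      wordWeight w {u | u ++ k ∈ P.curveWords τ (P.lowerConst τ) p k ∪
        P.swap.curveWords (-τ) (P.swap.lowerConst (-τ)) p k} ≤ ε τ := by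
    intro τ
    obtain ⟨C, hC⟩ := P.exists_wordWeight_curveWords_le hR0 hRN hM
      (P.lowerConst_pos (hne τ)) (τ := τ)
    obtain ⟨C', hC'⟩ := P.swap.exists_wordWeight_curveWords_le hR0 hRN hM
      (P.swap.lowerConst_pos (neg_ne_zero.2 (hne τ))) (τ := -τ)
    have hlim : Filter.Tendsto (fun p : ℕ => ((C + C' : ℕ) : ℝ≥0∞) * ((R : ℝ≥0∞)⁻¹) ^ p)
        Filter.atTop (nhds (((C + C' : ℕ) : ℝ≥0∞) * 0)) :=
      ENNReal.Tendsto.const_mul (ENNReal.tendsto_pow_atTop_nhds_zero_of_lt_one hRinv)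
        (Or.inr (by finiteness))
    rw [mul_zero] at hlim
    obtain ⟨p, hp⟩ := (hlim.eventually (gt_mem_nhds (hε τ))).exists
    refine ⟨p, fun k => le_trans ?_ hp.le⟩
    refine (wordWeight_union_le w {u | u ++ k ∈ P.curveWords τ (P.lowerConst τ) p k}
      {u | u ++ k ∈ P.swap.curveWords (-τ) (P.swap.lowerConst (-τ)) p k}).trans ?_
    push_cast
    rw [add_mul]
    exact add_le_add (hC p k) (hC' p k)
  choose p hp using hpex
  set G : List (∀ j, Fin (M j)) → Set (List (∀ j, Fin (M j))) := fun k =>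
    (P.rationalWords k ∪ P.swap.rationalWords k) ∪
      ⋃ τ : B, (P.curveWords τ (P.lowerConst τ) (p τ) k ∪
        P.swap.curveWords (-τ) (P.swap.lowerConst (-τ)) (p τ) k) with hGdef
  have h64 : 4 * (R : ℝ≥0∞)⁻¹ ≤ 1 / 16 := by
    rw [← div_eq_mul_inv]
    refine ENNReal.div_le_of_le_mul ?_
    calc (4 : ℝ≥0∞) = 1 / 16 * 64 := by
          rw [one_div, show (64 : ℝ≥0∞) = 16 * 4 by norm_num, ← mul_assoc,
            ENNReal.inv_mul_cancel (by norm_num) (by norm_num), one_mul]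
      _ ≤ 1 / 16 * R := by gcongr; exact_mod_cast hR
  have hG : ∀ k, wordWeight w {u | u ++ k ∈ G k} ≤ 1 / 4 := by
    intro k
    have e : {u | u ++ k ∈ G k} = ({u | u ++ k ∈ P.rationalWords k} ∪
        {u | u ++ k ∈ P.swap.rationalWords k}) ∪
        ⋃ τ : B, {u | u ++ k ∈ P.curveWords τ (P.lowerConst τ) (p τ) k ∪
        P.swap.curveWords (-τ) (P.swap.lowerConst (-τ)) (p τ) k} := by
      ext u
      simp only [hGdef, Set.mem_union, Set.mem_iUnion, Set.mem_ofPred_eq]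
    rw [e]
    refine (wordWeight_union_le _ _ _).trans ?_
    refine (add_le_add ((wordWeight_union_le _ _ _).trans (add_le_add
      (P.wordWeight_rationalWords_le hR0 hRN hM k)
      (P.swap.wordWeight_rationalWords_le hR0 hRN hM k)))
      ((wordWeight_iUnion_le _ _).trans
        ((ENNReal.tsum_le_tsum fun τ => hp τ k).trans hεsum.le))).trans ?_
    refine (add_le_add (add_le_add h64 h64) le_rfl).trans ?_
    rw [← ENNReal.toReal_le_toReal (by finiteness) (by finiteness),
      ENNReal.toReal_add (by finiteness) (by finiteness),
      ENNReal.toReal_add (by finiteness) (by finiteness)]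
    simp
    norm_num
  obtain ⟨S, hS0, hSK, hSG⟩ := exists_subtree w G hG K (by
    intro c hc
    have hprod : 0 < ∏ j, M j := Finset.prod_pos fun j _ => hM j
    rw [hw, ← mul_div_assoc, ENNReal.div_le_iff (by exact_mod_cast hprod.ne') (by finiteness)]
      at hc
    have hc' : c * R ≤ 2 * ∏ j, M j := by exact_mod_cast hc
    rw [Fintype.card_pi]
    simp only [Fintype.card_fin]
    refine Nat.le_of_mul_le_mul_left (?_ : R * (K + c) ≤ R * _) hR0
    nlinarith)
  refine ⟨S, hS0, hSK, ?_⟩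
  rintro t ⟨ν, hν⟩
  have hlen : ∀ n, (ν n).length = n := fun n => (hν n).1
  have hsucc : ∀ n, ∃ d, ν (n + 1) = d :: ν n := fun n => (hν n).2.2.1
  have ht : ∀ n, t ∈ wordBox (ν n) := fun n => (hν n).2.2.2
  have hGν : ∀ n i, ν (n + i) ∉ G (ν n) := fun n i =>
    hSG _ (hν _).2.1 _ (suffix_of_le hsucc (Nat.le_add_right n i))
  have hba : ∀ n, P.BadlyApprox (ν n) := badlyApprox_of_notMem hlen hsucc fun n h =>
    hGν n 1 (Or.inl (Or.inl h))
  have hbb : ∀ n, P.swap.BadlyApprox (ν n) := badlyApprox_of_notMem hlen hsucc fun n h =>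
    hGν n 1 (Or.inl (Or.inr h))
  refine ⟨fun q p hq => BadlyApprox.of_forall hlen hba ht hq p,
    fun q p hq => BadlyApprox.of_forall hlen hbb ht hq p, fun τ hτ => ?_⟩
  have hτ0 := hne ⟨τ, hτ⟩
  refine ⟨min (((N : ℝ) ^ p ⟨τ, hτ⟩)⁻¹) (|τ| * P.κ / 2), ?_, fun m => ?_⟩
  · have := P.κ_pos
    have := abs_pos.2 hτ0
    have := P.base_pow_pos (p ⟨τ, hτ⟩)
    positivity
  · rcases le_total |P.form₁ t m| |P.form₂ t m| with hle | hle
    · exact (lt_abs_of_notMem_curveWords hlen hsucc hba (fun n h => hGν n (p ⟨τ, hτ⟩)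
        (Or.inr (Set.mem_iUnion.2 ⟨⟨τ, hτ⟩, Or.inl h⟩))) ht hle).le
    · have h1 := (lt_abs_of_notMem_curveWords (P := P.swap) (τ := -τ) hlen hsucc hbb
        (fun n h => hGν n (p ⟨τ, hτ⟩)
        (Or.inr (Set.mem_iUnion.2 ⟨⟨τ, hτ⟩, Or.inr h⟩))) ht (m := m) hle).le
      rw [abs_neg] at h1
      refine h1.trans (le_of_eq ?_)
      congr 1
      change P.form₂ t m * P.form₁ t m - -τ * (P.crd t P.b - P.crd t P.a) = _
      ring

end FormChart

theorem dimH_image_le_of_contDiffAt {E F : Type*} [NormedAddCommGroup E] [NormedSpace ℝ E]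
    [SecondCountableTopology E] [NormedAddCommGroup F] [NormedSpace ℝ F] {f : E → F} {s : Set E}
    (hf : ∀ x ∈ s, ContDiffAt ℝ 1 f x) : dimH (f '' s) ≤ dimH s :=
  dimH_image_le_of_locally_lipschitzOn fun x hx =>
    let ⟨C, u, hu, h⟩ := (hf x hx).exists_lipschitzOnWith
    ⟨C, u, mem_nhdsWithin_of_mem_nhds hu, h⟩

/-- The number of subdivisions in each coordinate: two slopes, two translations and a scale. -/
def chartBase (N : ℕ) : Fin 5 → ℕ := ![N ^ 2, N ^ 2, N, N, N]

theorem exists_formChart {N : ℕ} (hN : 1 < N) (cen : Fin 5 → ℝ) (h : cen 0 ≠ cen 1) {r : ℝ}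
    (hr : 0 < r) : ∃ P : FormChart (chartBase N) N, P.a = 0 ∧ P.b = 1 ∧ P.x = 2 ∧ P.y = 3 ∧
      P.cen = cen ∧ P.ρ < r := by
  set κ : ℝ := min 1 (|cen 0 - cen 1| / 2) with hκ
  set Y : ℝ := |cen 2 - cen 3| + 1 with hY
  have hκ0 : 0 < κ := by positivity
  have hκ1 : κ ≤ 1 := min_le_left _ _
  have hκ2 : κ ≤ |cen 0 - cen 1| / 2 := min_le_right _ _
  set ρ : ℝ := min (κ / 8 / (2 + Y / κ)) (r / 2) with hρ
  have hρ0 : 0 < ρ := by positivity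
  have hsmall : (2 + Y / κ) * ρ ≤ κ / 8 := by
    rw [mul_comm, ← le_div_iff₀ (by positivity)]
    exact min_le_left _ _
  have hρκ : 2 * ρ ≤ κ / 8 := by
    refine le_trans ?_ hsmall
    have : 0 ≤ Y / κ := by positivity
    nlinarith
  have hbd : ∀ t ∈ wordBox (M := chartBase N) [], ∀ i j,
      |(cen i + ρ * t i) - (cen j + ρ * t j) - (cen i - cen j)| ≤ ρ := by
    intro t ht i j
    have h1 := ht i
    have h2 := ht j
    simp only [wordIdx, List.length_nil, pow_zero, mul_one] at h1 h2
    rw [abs_le]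
    push_cast at h1 h2
    constructor <;> nlinarith [h1.1, h1.2, h2.1, h2.2]
  refine ⟨{ a := 0, b := 1, x := 2, y := 3, cen := cen, ρ := ρ, κ := κ,
            L := |cen 0 - cen 1| + 1, Y := Y, base_a := rfl, base_b := rfl, base_x := rfl,
            base_y := rfl, a_ne_x := by decide, b_ne_x := by decide, a_ne_y := by decide,
            b_ne_y := by decide, x_ne_y := by decide, one_lt := hN, ρ_pos := hρ0,
            ρ_le := by linarith, κ_pos := hκ0, κ_le_one := hκ1, Y_nonneg := by positivity,
            small := hsmall, κ_le := fun t ht => ?_, le_L := fun t ht => ?_,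
            le_Y := fun t ht => ?_ }, rfl, rfl, rfl, rfl, rfl, ?_⟩
  · have h1 := hbd t ht 0 1
    have h2 := abs_sub_abs_le_abs_sub (cen 0 - cen 1) ((cen 0 + ρ * t 0) - (cen 1 + ρ * t 1))
    rw [abs_sub_comm] at h1
    linarith
  · have h1 := hbd t ht 0 1
    have h2 := abs_sub_abs_le_abs_sub ((cen 0 + ρ * t 0) - (cen 1 + ρ * t 1)) (cen 0 - cen 1)
    linarith
  · have h1 := hbd t ht 2 3
    have h2 := abs_sub_abs_le_abs_sub ((cen 2 + ρ * t 2) - (cen 3 + ρ * t 3)) (cen 2 - cen 3)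
    linarith
  · have : ρ ≤ r / 2 := min_le_right _ _
    change ρ < r
    linarith

/-- Parameters with badly approximable slopes `z 0`, `z 1` whose values stay away from each
element of `B`. -/
def goodParams (B : Set ℝ) : Set (Fin 5 → ℝ) :=
  {z | (∃ c > 0, ∀ q p : ℤ, q ≠ 0 → c ≤ |q * z 0 + p| * |(q : ℝ)|) ∧
    (∃ c > 0, ∀ q p : ℤ, q ≠ 0 → c ≤ |q * z 1 + p| * |(q : ℝ)|) ∧
    ∀ τ ∈ B, ∃ δ > 0, ∀ m₁ m₂ : ℤ,
      δ ≤ |(z 0 * m₁ + m₂ + z 2) * (z 1 * m₁ + m₂ + z 3) - τ * (z 0 - z 1)|}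

theorem exists_large_scale {s : ℝ} (hs : s < 5) :
    ∃ R : ℕ, 64 ≤ R ∧ (2 : ℝ) ≤ ((R ^ 2 : ℕ) : ℝ) ^ (5 - s) := by
  have h1 : Filter.Tendsto (fun R : ℕ => ((R ^ 2 : ℕ) : ℝ) ^ (5 - s)) Filter.atTop
      Filter.atTop :=
    (tendsto_rpow_atTop (by linarith)).comp (tendsto_natCast_atTop_atTop.comp
      (Filter.tendsto_pow_atTop two_ne_zero))
  obtain ⟨R, h2, h3⟩ := ((h1.eventually_ge_atTop 2).and (Filter.eventually_ge_atTop 64)).exists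
  exact ⟨R, h3, h2⟩

theorem le_dimH_goodParams_inter {B : Set ℝ} (hB : B.Countable) (h0 : (0 : ℝ) ∉ B)
    {cen : Fin 5 → ℝ} (h : cen 0 ≠ cen 1) {V : Set (Fin 5 → ℝ)} (hV : V ∈ nhds cen) {s : ℝ≥0}
    (hs0 : 0 < s) (hs : s < 5) : (s : ℝ≥0∞) ≤ dimH (goodParams B ∩ V) := by
  obtain ⟨r, hr, hrV⟩ := Metric.mem_nhds_iff.1 hV
  obtain ⟨R, hR, hR2⟩ := exists_large_scale (s := s) (by exact_mod_cast hs)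
  have hN1 : 1 < R ^ 2 := Nat.one_lt_pow two_ne_zero (by omega)
  set N := R ^ 2 with hN
  have hMN : ∀ j, N ≤ chartBase N j := by
    have : N ≤ N ^ 2 := Nat.le_self_pow two_ne_zero N
    intro j
    fin_cases j <;> simp [chartBase, this]
  have hM : ∀ j, 0 < chartBase N j := fun j => by have := hMN j; omega
  have hprod : ∏ j, chartBase N j = R ^ 14 := by
    simp only [Fin.prod_univ_five, chartBase, hN]
    simp
    ring
  obtain ⟨P, ha, hb, hx, hy, hcen, hρ⟩ := exists_formChart hN1 cen h hr
  obtain ⟨S, hS0, hSK, hS⟩ := P.exists_tree hR le_rfl hM (K := R ^ 13 * (R - 2)) (by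
    rw [hprod]
    obtain ⟨Q, rfl⟩ : ∃ Q, R = Q + 2 := ⟨R - 2, by omega⟩
    simp only [Nat.add_sub_cancel]
    apply le_of_eq
    ring) hB h0
  have hK0 : 0 < R ^ 13 * (R - 2) := Nat.mul_pos (by positivity) (by omega)
  have hdim := le_dimH_treeLimit (N := N) hN1 hMN S hS0 _ hK0 hSK s hs0 (by
    rw [Fintype.card_fin]; exact_mod_cast hs.le) (by
    rw [Fintype.card_fin]
    have e : (∏ j, (chartBase N j : ℝ)) = (R : ℝ) ^ 14 := by exact_mod_cast hprod
    rw [e]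
    have hRr : (64 : ℝ) ≤ R := by exact_mod_cast hR
    have e2 : ((R ^ 13 * (R - 2) : ℕ) : ℝ) = (R : ℝ) ^ 13 * (R - 2) := by
      rw [Nat.cast_mul, Nat.cast_pow, Nat.cast_sub (by omega)]
      norm_num
    rw [e2]
    calc (R : ℝ) ^ 14 = (R : ℝ) ^ 13 * R := by ring
      _ ≤ (R : ℝ) ^ 13 * ((R - 2) * 2) := by gcongr; linarith
      _ = (R : ℝ) ^ 13 * (R - 2) * 2 := by ring
      _ ≤ _ := by
        have : (0 : ℝ) ≤ R - 2 := by linarith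
        gcongr
        exact_mod_cast hR2)
  refine hdim.trans ?_
  have hρ0 := P.ρ_pos
  have hsub : treeLimit S ⊆ (fun z : Fin 5 → ℝ => fun j => (z j - P.cen j) / P.ρ) ''
      (goodParams B ∩ V) := by
    intro t ht
    refine ⟨P.crd t, ⟨?_, hrV ?_⟩, ?_⟩
    · obtain ⟨h1, h2, h3⟩ := hS t ht
      rw [ha] at h1
      rw [hb] at h2
      have hN4 := P.base_pow_pos 4
      refine ⟨⟨P.ρ / (N : ℝ) ^ 4, by positivity, fun q p hq => ?_⟩,
        ⟨P.ρ / (N : ℝ) ^ 4, by positivity, fun q p hq => ?_⟩, fun τ hτ => ?_⟩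
      · rw [div_le_iff₀ hN4]; exact (h1 q p hq).le
      · rw [div_le_iff₀ hN4]; exact (h2 q p hq).le
      · obtain ⟨δ, hδ, h4⟩ := h3 τ hτ
        refine ⟨δ, hδ, fun m₁ m₂ => ?_⟩
        have := h4 (m₁, m₂)
        rwa [FormChart.form₁, FormChart.form₂, ha, hb, hx, hy] at this
    · obtain ⟨ν, hν⟩ := ht
      have ht0 : t ∈ wordBox (M := chartBase N) [] :=
        wordBox_antitone (List.nil_suffix) (hν 0).2.2.2
      rw [Metric.mem_ball]
      refine lt_of_le_of_lt ((dist_pi_le_iff hρ0.le).2 fun j => ?_) hρ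
      have h1 := ht0 j
      simp only [wordIdx, List.length_nil, pow_zero, mul_one] at h1
      push_cast at h1
      rw [Real.dist_eq, ← hcen, FormChart.crd, add_sub_cancel_left, abs_mul, abs_of_pos hρ0]
      refine mul_le_of_le_one_right hρ0.le (abs_le.2 ⟨by linarith [h1.1], by linarith [h1.2]⟩)
    · funext j
      simp only [FormChart.crd]
      field_simp
      ring
  refine (dimH_mono hsub).trans (dimH_image_le_of_contDiffAt fun z _ => ?_)
  fun_prop

/-- The pairs with bounded diagonal orbit and value set avoiding `B`. -/
def boundedAvoiding (B : Set ℝ) : Set ((Fin 2 → Fin 2 → ℝ) × (Fin 2 → ℝ)) :=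
  {p | isSL2 p.1 ∧
    (∃ ε : ℝ, 0 < ε ∧ ∀ (t : ℝ) (m : Fin 2 → ℤ), m ≠ 0 →
      ε ≤ euclNorm2 (matVec (btMul t p.1) fun i => (m i : ℝ))) ∧
    closure (affValSet p.1 p.2) ∩ B = ∅}

/-- The affine lattice with slopes `z 0`, `z 1`, translations `z 2`, `z 3` and scale `z 4`. -/
noncomputable def latticeOfParams (z : Fin 5 → ℝ) : (Fin 2 → Fin 2 → ℝ) × (Fin 2 → ℝ) :=
  (![![z 4 * z 0, z 4], ![(z 4 * (z 0 - z 1))⁻¹ * z 1, (z 4 * (z 0 - z 1))⁻¹]],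
    ![z 4 * z 2, (z 4 * (z 0 - z 1))⁻¹ * z 3])

/-- The parameters of an affine lattice. -/
noncomputable def paramsOfLattice (p : (Fin 2 → Fin 2 → ℝ) × (Fin 2 → ℝ)) : Fin 5 → ℝ :=
  ![p.1 0 0 / p.1 0 1, p.1 1 0 / p.1 1 1, p.2 0 / p.1 0 1, p.2 1 / p.1 1 1, p.1 0 1]

theorem paramsOfLattice_latticeOfParams {z : Fin 5 → ℝ} (h4 : z 4 ≠ 0) (h : z 0 ≠ z 1) :
    paramsOfLattice (latticeOfParams z) = z := by
  funext j
  fin_cases j <;> simp [paramsOfLattice, latticeOfParams] <;> field_simp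

theorem paramsOfLattice_sub {p : (Fin 2 → Fin 2 → ℝ) × (Fin 2 → ℝ)} (hp : isSL2 p.1)
    (h0 : p.1 0 1 ≠ 0) (h1 : p.1 1 1 ≠ 0) :
    paramsOfLattice p 0 - paramsOfLattice p 1 = (p.1 0 1 * p.1 1 1)⁻¹ := by
  unfold isSL2 at hp
  simp only [paramsOfLattice, Matrix.cons_val_zero, Matrix.cons_val_one]
  rw [div_sub_div _ _ h0 h1, hp, one_div]

theorem latticeOfParams_paramsOfLattice {p : (Fin 2 → Fin 2 → ℝ) × (Fin 2 → ℝ)}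
    (hp : isSL2 p.1) (h0 : p.1 0 1 ≠ 0) (h1 : p.1 1 1 ≠ 0) :
    latticeOfParams (paramsOfLattice p) = p := by
  have h := paramsOfLattice_sub hp h0 h1
  have h4 : paramsOfLattice p 4 = p.1 0 1 := rfl
  have e : (p.1 0 1 * (p.1 0 1 * p.1 1 1)⁻¹)⁻¹ = p.1 1 1 := by field_simp
  unfold latticeOfParams
  rw [h, h4, e]
  refine Prod.ext (funext fun i => funext fun j => ?_) (funext fun i => ?_)
  · fin_cases i <;> fin_cases j <;> simp [paramsOfLattice] <;> field_simp
  · fin_cases i <;> simp [paramsOfLattice] <;> field_simp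

theorem exists_le_abs_mul_of_badlyApprox {α β c : ℝ} (h : α ≠ β) (hc : 0 < c)
    (hα : ∀ q p : ℤ, q ≠ 0 → c ≤ |q * α + p| * |(q : ℝ)|)
    (hβ : ∀ q p : ℤ, q ≠ 0 → c ≤ |q * β + p| * |(q : ℝ)|) :
    ∃ c' > 0, ∀ q p : ℤ, ¬ (q = 0 ∧ p = 0) → c' ≤ |(q * α + p) * (q * β + p)| := by
  refine ⟨min 1 (c * (|α - β| / 2)), by positivity, fun q p hqp => ?_⟩
  by_cases hq : q = 0
  · have hp : p ≠ 0 := fun hp => hqp ⟨hq, hp⟩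
    refine (min_le_left _ _).trans ?_
    rw [hq]
    simp only [Int.cast_zero, zero_mul, zero_add]
    exact_mod_cast Int.one_le_abs (mul_ne_zero hp hp)
  · refine (min_le_right _ _).trans ?_
    rw [abs_mul]
    have h1 : |α - β| * |(q : ℝ)| ≤ |q * α + p| + |q * β + p| := by
      rw [← abs_mul]
      refine le_trans (le_of_eq ?_) (abs_sub _ _)
      congr 1
      ring
    rcases le_total |q * α + p| |q * β + p| with hle | hle
    · calc c * (|α - β| / 2) ≤ |q * α + p| * |(q : ℝ)| * (|α - β| / 2) := by
            gcongr; exact hα q p hq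
        _ = |q * α + p| * (|α - β| * |(q : ℝ)| / 2) := by ring
        _ ≤ _ := by gcongr; linarith
    · calc c * (|α - β| / 2) ≤ |q * β + p| * |(q : ℝ)| * (|α - β| / 2) := by
            gcongr; exact hβ q p hq
        _ = (|α - β| * |(q : ℝ)| / 2) * |q * β + p| := by ring
        _ ≤ _ := by gcongr; linarith

theorem sqrt_two_mul_abs_mul_le_euclNorm2 (t : ℝ) (g : Fin 2 → Fin 2 → ℝ) (v : Fin 2 → ℝ) :
    √(2 * |matVec g v 0 * matVec g v 1|) ≤ euclNorm2 (matVec (btMul t g) v) := by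
  refine Real.sqrt_le_sqrt ?_
  have h0 : matVec (btMul t g) v 0 = Real.exp t * matVec g v 0 := by
    simp [matVec, btMul]; ring
  have h1 : matVec (btMul t g) v 1 = Real.exp (-t) * matVec g v 1 := by
    simp [matVec, btMul]; ring
  have he : Real.exp t * Real.exp (-t) = 1 := by rw [← Real.exp_add]; simp
  have h2 : |matVec g v 0 * matVec g v 1| =
      |matVec (btMul t g) v 0| * |matVec (btMul t g) v 1| := by
    rw [← abs_mul, h0, h1]
    congr 1
    linear_combination (-(matVec g v 0 * matVec g v 1)) * he
  rw [h2, ← sq_abs (matVec (btMul t g) v 0), ← sq_abs (matVec (btMul t g) v 1), ← mul_assoc]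
  exact two_mul_le_add_sq _ _

theorem latticeOfParams_mem {B : Set ℝ} {z : Fin 5 → ℝ} (hz : z ∈ goodParams B) (h4 : z 4 ≠ 0)
    (h : z 0 ≠ z 1) : latticeOfParams z ∈ boundedAvoiding B := by
  have hD := sub_ne_zero.2 h
  have hDa : 0 < |z 0 - z 1| := abs_pos.2 hD
  obtain ⟨⟨c, hc, hα⟩, ⟨c', hc', hβ⟩, hB⟩ := hz
  refine ⟨?_, ?_, ?_⟩
  · simp only [isSL2, latticeOfParams, Matrix.cons_val_zero, Matrix.cons_val_one]
    field_simp
  · obtain ⟨ε, hε, hεle⟩ := exists_le_abs_mul_of_badlyApprox h (lt_min hc hc')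
      (fun q p hq => (min_le_left _ _).trans (hα q p hq))
      (fun q p hq => (min_le_right _ _).trans (hβ q p hq))
    refine ⟨√(2 * (ε / |z 0 - z 1|)), by positivity, fun t m hm => ?_⟩
    refine le_trans (Real.sqrt_le_sqrt ?_) (sqrt_two_mul_abs_mul_le_euclNorm2 t _ _)
    have h1 := hεle (m 0) (m 1) fun h => hm (funext fun i => by
      fin_cases i
      · exact h.1
      · exact h.2)
    have e : matVec (latticeOfParams z).1 (fun i => (m i : ℝ)) 0 *
        matVec (latticeOfParams z).1 (fun i => (m i : ℝ)) 1 =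
        (m 0 * z 0 + m 1) * (m 0 * z 1 + m 1) / (z 0 - z 1) := by
      simp only [matVec, latticeOfParams, Matrix.cons_val_zero, Matrix.cons_val_one]
      field_simp
    rw [e, abs_div]
    gcongr
  · rw [Set.eq_empty_iff_forall_notMem]
    rintro τ ⟨hτ, hτB⟩
    obtain ⟨δ, hδ, hle⟩ := hB τ hτB
    obtain ⟨v, ⟨m₁, m₂, rfl⟩, hv⟩ := Metric.mem_closure_iff.1 hτ (δ / |z 0 - z 1|)
      (by positivity)
    have h1 := hle m₁ m₂
    rw [lt_div_iff₀ hDa, dist_comm, Real.dist_eq, ← abs_mul] at hv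
    refine (hv.trans_le h1).ne (congrArg abs ?_)
    simp only [latticeOfParams, Matrix.cons_val_zero, Matrix.cons_val_one]
    field_simp

theorem continuousAt_latticeOfParams {z₀ : Fin 5 → ℝ} (h4 : z₀ 4 ≠ 0) (h : z₀ 0 ≠ z₀ 1) :
    ContinuousAt latticeOfParams z₀ := by
  have hp (i : Fin 5) : ContinuousAt (fun z : Fin 5 → ℝ => z i) z₀ :=
    (continuous_apply i).continuousAt
  have hi : ContinuousAt (fun z : Fin 5 → ℝ => (z 4 * (z 0 - z 1))⁻¹) z₀ :=
    ((hp 4).mul ((hp 0).sub (hp 1))).inv₀ (mul_ne_zero h4 (sub_ne_zero.2 h))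
  refine ContinuousAt.prodMk (continuousAt_pi.2 fun i => continuousAt_pi.2 fun j => ?_)
    (continuousAt_pi.2 fun i => ?_)
  · fin_cases i <;> fin_cases j
    exacts [(hp 4).mul (hp 0), hp 4, hi.mul (hp 1), hi]
  · fin_cases i
    exacts [(hp 4).mul (hp 2), hi.mul (hp 3)]

theorem eventually_add_mul_ne_zero {a b : ℝ} (h : ¬ (a = 0 ∧ b = 0)) :
    ∀ᶠ t in nhdsWithin (0 : ℝ) {0}ᶜ, a + t * b ≠ 0 := by
  by_cases ha : a = 0
  · have hb : b ≠ 0 := fun hb => h ⟨ha, hb⟩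
    filter_upwards [self_mem_nhdsWithin] with t ht
    rw [ha, zero_add]
    exact mul_ne_zero ht hb
  · refine Filter.Eventually.filter_mono nhdsWithin_le_nhds ?_
    have : ContinuousAt (fun t : ℝ => a + t * b) 0 := by fun_prop
    exact this.eventually_ne (by simpa using ha)

theorem exists_mem_isSL2_ne_zero {U : Set ((Fin 2 → Fin 2 → ℝ) × (Fin 2 → ℝ))}
    (hU : IsOpen U) (h : (U ∩ {p | isSL2 p.1}).Nonempty) :
    ∃ p ∈ U, isSL2 p.1 ∧ p.1 0 1 ≠ 0 ∧ p.1 1 1 ≠ 0 := by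
  obtain ⟨⟨g, w⟩, hgU, hg⟩ := h
  change g 0 0 * g 1 1 - g 0 1 * g 1 0 = 1 at hg
  set f : ℝ → (Fin 2 → Fin 2 → ℝ) × (Fin 2 → ℝ) := fun t =>
    (![![g 0 0, g 0 1 + t * g 0 0], ![g 1 0, g 1 1 + t * g 1 0]], w) with hf
  have hf0 : f 0 = (g, w) := by
    refine Prod.ext (funext fun i => funext fun j => ?_) rfl
    fin_cases i <;> fin_cases j <;> simp [hf]
  have hfc : Continuous f := by
    refine Continuous.prodMk (continuous_pi fun i => continuous_pi fun j => ?_) continuous_const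
    fin_cases i <;> fin_cases j <;> simp <;> fun_prop
  have h1 : ∀ᶠ t in nhdsWithin (0 : ℝ) {0}ᶜ, f t ∈ U :=
    Filter.Eventually.filter_mono nhdsWithin_le_nhds
      (hfc.continuousAt.eventually_mem (hU.mem_nhds (by rw [hf0]; exact hgU)))
  have h2 := eventually_add_mul_ne_zero (a := g 0 1) (b := g 0 0) fun h => by
    rw [h.1, h.2] at hg; norm_num at hg
  have h3 := eventually_add_mul_ne_zero (a := g 1 1) (b := g 1 0) fun h => by
    rw [h.1, h.2] at hg; norm_num at hg
  obtain ⟨t, ht1, ht2, ht3⟩ := (h1.and (h2.and h3)).exists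
  refine ⟨f t, ht1, ?_, ht2, ht3⟩
  simp only [isSL2, hf, Matrix.cons_val_zero, Matrix.cons_val_one]
  linear_combination hg

theorem five_le_dimH {B : Set ℝ} (hB : B.Countable) (h0 : (0 : ℝ) ∉ B)
    {U : Set ((Fin 2 → Fin 2 → ℝ) × (Fin 2 → ℝ))} (hU : IsOpen U)
    (h : (U ∩ {p | isSL2 p.1}).Nonempty) : 5 ≤ dimH (boundedAvoiding B ∩ U) := by
  obtain ⟨p, hpU, hp, hp0, hp1⟩ := exists_mem_isSL2_ne_zero hU h
  set cen := paramsOfLattice p with hcen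
  have hne : cen 0 ≠ cen 1 := by
    rw [← sub_ne_zero, hcen, paramsOfLattice_sub hp hp0 hp1]
    positivity
  have hne' := sub_ne_zero.2 hne
  have h4 : cen 4 ≠ 0 := hp0
  have hcont := continuousAt_latticeOfParams h4 hne
  set V : Set (Fin 5 → ℝ) := {z | latticeOfParams z ∈ U ∧ z 4 ≠ 0 ∧ z 0 ≠ z 1} with hV
  have hVn : V ∈ nhds cen := by
    refine Filter.inter_mem (hcont.preimage_mem_nhds (hU.mem_nhds ?_)) (Filter.inter_mem ?_ ?_)
    · rw [hcen, latticeOfParams_paramsOfLattice hp hp0 hp1]; exact hpU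
    · exact (continuous_apply (4 : Fin 5)).continuousAt.eventually_ne h4
    · have hc : ContinuousAt (fun z : Fin 5 → ℝ => z 0 - z 1) cen := by fun_prop
      filter_upwards [hc.eventually_ne hne'] with z hz
      exact sub_ne_zero.1 hz
  have key : dimH (goodParams B ∩ V) ≤ dimH (boundedAvoiding B ∩ U) := by
    set T := (boundedAvoiding B ∩ U) ∩ {p | p.1 0 1 ≠ 0 ∧ p.1 1 1 ≠ 0} with hT
    have hsub : goodParams B ∩ V ⊆ paramsOfLattice '' T := by
      rintro z ⟨hz, hzU, hz4, hz01⟩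
      refine ⟨latticeOfParams z, ⟨⟨latticeOfParams_mem hz hz4 hz01, hzU⟩, hz4, ?_⟩,
        paramsOfLattice_latticeOfParams hz4 hz01⟩
      exact inv_ne_zero (mul_ne_zero hz4 (sub_ne_zero.2 hz01))
    refine (dimH_mono hsub).trans ((dimH_image_le_of_contDiffAt ?_).trans
      (dimH_mono Set.inter_subset_left))
    rintro q ⟨-, hq0, hq1⟩
    refine contDiffAt_pi.2 fun j => ?_
    fin_cases j <;> simp [paramsOfLattice] <;> fun_prop (disch := assumption)
  refine le_trans ?_ key
  refine ENNReal.le_of_forall_nnreal_lt fun s hs => ?_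
  rcases eq_or_ne s 0 with rfl | hs0
  · simp
  · exact le_dimH_goodParams_inter hB h0 hne hVn (pos_iff_ne_zero.2 hs0) (by exact_mod_cast hs)

theorem dimH_isSL2_le : dimH {p : (Fin 2 → Fin 2 → ℝ) × (Fin 2 → ℝ) | isSL2 p.1} ≤ 5 := by
  set f₁ : (Fin 5 → ℝ) → (Fin 2 → Fin 2 → ℝ) × (Fin 2 → ℝ) := fun z =>
    (![![z 0, z 1], ![z 2, (1 + z 1 * z 2) / z 0]], ![z 3, z 4]) with hf₁
  set f₂ : (Fin 5 → ℝ) → (Fin 2 → Fin 2 → ℝ) × (Fin 2 → ℝ) := fun z =>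
    (![![z 1, z 0], ![(z 1 * z 2 - 1) / z 0, z 2]], ![z 3, z 4]) with hf₂
  have hsub : {p : (Fin 2 → Fin 2 → ℝ) × (Fin 2 → ℝ) | isSL2 p.1} ⊆
      f₁ '' {z | z 0 ≠ 0} ∪ f₂ '' {z | z 0 ≠ 0} := by
    rintro ⟨g, w⟩ hg
    change g 0 0 * g 1 1 - g 0 1 * g 1 0 = 1 at hg
    by_cases h : g 0 0 = 0
    · have h' : g 0 1 ≠ 0 := fun h' => by rw [h, h'] at hg; norm_num at hg
      refine Or.inr ⟨![g 0 1, g 0 0, g 1 1, w 0, w 1], h', ?_⟩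
      refine Prod.ext (funext fun i => funext fun j => ?_) (funext fun i => ?_)
      · fin_cases i <;> fin_cases j <;> simp [hf₂]
        field_simp
        linear_combination hg
      · fin_cases i <;> simp [hf₂]
    · refine Or.inl ⟨![g 0 0, g 0 1, g 1 0, w 0, w 1], h, ?_⟩
      refine Prod.ext (funext fun i => funext fun j => ?_) (funext fun i => ?_)
      · fin_cases i <;> fin_cases j <;> simp [hf₁]
        field_simp
        linear_combination -hg
      · fin_cases i <;> simp [hf₁]
  have h5 : dimH {z : Fin 5 → ℝ | z 0 ≠ 0} ≤ 5 :=
    (dimH_mono (Set.subset_univ _)).trans_eq (by exact_mod_cast Real.dimH_univ_pi_fin 5)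
  refine (dimH_mono hsub).trans ?_
  rw [dimH_union]
  refine max_le ((dimH_image_le_of_contDiffAt fun z hz => ?_).trans h5)
    ((dimH_image_le_of_contDiffAt fun z hz => ?_).trans h5)
  all_goals
    refine ContDiffAt.prodMk (contDiffAt_pi.2 fun i => contDiffAt_pi.2 fun j => ?_)
      (contDiffAt_pi.2 fun i => ?_)
    · fin_cases i <;> fin_cases j <;> simp <;> fun_prop (disch := assumption)
    · fin_cases i <;> simp <;> fun_prop

/-- The set of `(g,w) ∈ SL(2,ℝ) × ℝ²` whose full diagonal orbit is bounded and whose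
value set `Q₀(gℤ²+w)` has closure avoiding a given countable set `B` with `0 ∉ B` is
thick: full Hausdorff dimension `5` in every open set meeting `SL(2,ℝ) × ℝ²`. -/
theorem stmt17 (B : Set ℝ) (hB : B.Countable) (h0 : (0 : ℝ) ∉ B) :
    ∀ U : Set ((Fin 2 → Fin 2 → ℝ) × (Fin 2 → ℝ)), IsOpen U →
      (U ∩ {p | isSL2 p.1}).Nonempty →
      dimH ({p : (Fin 2 → Fin 2 → ℝ) × (Fin 2 → ℝ) |
          isSL2 p.1 ∧
          (∃ ε : ℝ, 0 < ε ∧ ∀ (t : ℝ) (m : Fin 2 → ℤ), m ≠ 0 →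
            ε ≤ euclNorm2 (matVec (btMul t p.1) fun i => (m i : ℝ))) ∧
          closure (affValSet p.1 p.2) ∩ B = ∅} ∩ U) = 5 :=
  fun _ hU h => le_antisymm ((dimH_mono fun _ hp => hp.1.1).trans dimH_isSL2_le)
    (five_le_dimH hB h0 hU h)
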